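/- For all positive integers n and k, the number of NE-maximal 0-1-fillings of the staircase polyomino P_n whose longest north-east chain has length exactly k equals the number of SE-maximal 0-1-fillings of P_n whose longest south-east chain has length exactly k. -/

import Mathlib

open scoped Classical
noncomputable section

/-! ### Set partitions of type A -/

/-- A set partition of `[n] = {1,…,n}`: pairwise disjoint nonempty blocks covering `[n]`. -/
structure SetPartitionA (n : ℕ) where
  blocks : Finset (Finset ℕ)
  nonempty : ∀ B ∈ blocks, B.Nonempty
  disj : ∀ B ∈ blocks, ∀ B' ∈ blocks, B ≠ B' → Disjoint B B'
  cover : ∀ i : ℕ, (∃ B ∈ blocks, i ∈ B) ↔ i ∈ Finset.Icc 1 n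

/-- Two arcs `(i,j)`, `(i',j')` cross if `i<i'<j<j'` (in either order of the two arcs). -/
def ACross (a b : ℕ × ℕ) : Prop :=
  (a.1 < b.1 ∧ b.1 < a.2 ∧ a.2 < b.2) ∨ (b.1 < a.1 ∧ a.1 < b.2 ∧ b.2 < a.2)

/-- Two arcs `(i,j)`, `(i',j')` nest if `i<i'<j'<j` (in either order of the two arcs). -/
def ANest (a b : ℕ × ℕ) : Prop :=
  (a.1 < b.1 ∧ b.1 < b.2 ∧ b.2 < a.2) ∨ (b.1 < a.1 ∧ a.1 < a.2 ∧ a.2 < b.2)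

namespace SetPartitionA

variable {n : ℕ}

/-- Openers: elements of `[n]` that are not the maximum of their block. -/
def openers (P : SetPartitionA n) : Finset ℕ :=
  (Finset.Icc 1 n).filter fun i => ∃ B ∈ P.blocks, i ∈ B ∧ ∃ j ∈ B, i < j

/-- Closers: elements of `[n]` that are not the minimum of their block. -/
def closers (P : SetPartitionA n) : Finset ℕ :=
  (Finset.Icc 1 n).filter fun i => ∃ B ∈ P.blocks, i ∈ B ∧ ∃ j ∈ B, j < i

/-- `(i,j)` is an arc: `i < j` are in the same block with no block element in between. -/
def IsArc (P : SetPartitionA n) (i j : ℕ) : Prop :=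
  i < j ∧ ∃ B ∈ P.blocks, i ∈ B ∧ j ∈ B ∧ ∀ k ∈ B, ¬(i < k ∧ k < j)

/-- The finite set of arcs of `P`. -/
def arcs (P : SetPartitionA n) : Finset (ℕ × ℕ) :=
  ((Finset.Icc 1 n) ×ˢ (Finset.Icc 1 n)).filter fun p => P.IsArc p.1 p.2

/-- The number of crossings: pairs of arcs `(i,j)`, `(i',j')` with `i<i'<j<j'`. -/
def crossings (P : SetPartitionA n) : ℕ :=
  ((P.arcs ×ˢ P.arcs).filter fun q =>
    q.1.1 < q.2.1 ∧ q.2.1 < q.1.2 ∧ q.1.2 < q.2.2).card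

/-- The number of nestings: pairs of arcs `(i,j)`, `(i',j')` with `i<i'<j'<j`. -/
def nestings (P : SetPartitionA n) : ℕ :=
  ((P.arcs ×ˢ P.arcs).filter fun q =>
    q.1.1 < q.2.1 ∧ q.2.1 < q.2.2 ∧ q.2.2 < q.1.2).card

/-- The cardinality of a maximal crossing: largest set of mutually crossing arcs. -/
def maxCrossing (P : SetPartitionA n) : ℕ :=
  (P.arcs.powerset.filter fun S => ∀ a ∈ S, ∀ b ∈ S, a ≠ b → ACross a b).sup Finset.card

/-- The cardinality of a maximal nesting: largest set of mutually nesting arcs. -/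
def maxNesting (P : SetPartitionA n) : ℕ :=
  (P.arcs.powerset.filter fun S => ∀ a ∈ S, ∀ b ∈ S, a ≠ b → ANest a b).sup Finset.card

end SetPartitionA

/-! ### Set partitions of classical types B/C/D on `[±n]` -/

/-- Position of `i ∈ [±n]` in the type `C` nesting order `1<⋯<n<-n<⋯<-1`. -/
def nestOrd (n : ℕ) (i : ℤ) : ℤ := if 0 < i then i else 2 * n + 1 + i

/-- Position of `i ∈ [±n]` in the crossing order `1<⋯<n<-1<⋯<-n`. -/
def crossOrd (n : ℕ) (i : ℤ) : ℤ := if 0 < i then i else (n : ℤ) - i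

/-- Position of `i ∈ [±n] ∪ {0}` in the type `B` nesting order `1<⋯<n<0<-n<⋯<-1`. -/
def nestOrdB (n : ℕ) (i : ℤ) : ℤ :=
  if 0 < i then i else if i = 0 then (n : ℤ) + 1 else 2 * n + 2 + i

/-- The negative `-B` of a block. -/
def negSet (B : Finset ℤ) : Finset ℤ := B.image fun x => -x

/-- A set partition of type `B_n`/`C_n`: a set partition of `[±n]` with `B ∈ 𝓑 ↔ -B ∈ 𝓑`
and at most one block `B₀` with `B₀ = -B₀`. -/
structure SetPartitionC (n : ℕ) where
  blocks : Finset (Finset ℤ)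
  nonempty : ∀ B ∈ blocks, B.Nonempty
  disj : ∀ B ∈ blocks, ∀ B' ∈ blocks, B ≠ B' → Disjoint B B'
  cover : ∀ i : ℤ, (∃ B ∈ blocks, i ∈ B) ↔ (i ≠ 0 ∧ |i| ≤ (n : ℤ))
  symm : ∀ B ∈ blocks, negSet B ∈ blocks
  zeroBlock : ∀ B ∈ blocks, ∀ B' ∈ blocks, negSet B = B → negSet B' = B' → B = B'

/-- Endpoints of an arc, ordered by the crossing order. -/
def cpr (n : ℕ) (p : ℤ × ℤ) : ℤ × ℤ :=
  (min (crossOrd n p.1) (crossOrd n p.2), max (crossOrd n p.1) (crossOrd n p.2))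

/-- `p` crosses `q` with `p` coming first in the crossing order. -/
def CrossRel (n : ℕ) (p q : ℤ × ℤ) : Prop :=
  (cpr n p).1 < (cpr n q).1 ∧ (cpr n q).1 < (cpr n p).2 ∧ (cpr n p).2 < (cpr n q).2

/-- The two arcs `p`, `q` cross in the crossing diagram. -/
def Crosses (n : ℕ) (p q : ℤ × ℤ) : Prop := CrossRel n p q ∨ CrossRel n q p

/-- `p` nests over `q` in the nesting diagram (arcs written in nesting order). -/
def NestRel (n : ℕ) (p q : ℤ × ℤ) : Prop :=
  nestOrd n p.1 < nestOrd n q.1 ∧ nestOrd n q.2 < nestOrd n p.2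

/-- The two arcs `p`, `q` nest in the nesting diagram. -/
def Nests (n : ℕ) (p q : ℤ × ℤ) : Prop := NestRel n p q ∨ NestRel n q p

/-- `p` nests over `q` in the type `B` nesting diagram. -/
def NestRelB (n : ℕ) (p q : ℤ × ℤ) : Prop :=
  nestOrdB n p.1 < nestOrdB n q.1 ∧ nestOrdB n q.2 < nestOrdB n p.2

/-- The two arcs `p`, `q` nest in the type `B` nesting diagram. -/
def NestsB (n : ℕ) (p q : ℤ × ℤ) : Prop := NestRelB n p q ∨ NestRelB n q p

/-- Exceptional pairs for type `B` crossings: both arcs have positive opener and negative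
closer, and at least one closer is smaller in absolute value than its opener. -/
def ExcCross (p q : ℤ × ℤ) : Prop :=
  0 < p.1 ∧ p.2 < 0 ∧ 0 < q.1 ∧ q.2 < 0 ∧ (|p.2| < |p.1| ∨ |q.2| < |q.1|)

/-- Exceptional pairs for type `B` nestings: both arcs have positive opener (or begin at `0`)
and negative closer (or end at `0`), and at least one closer is smaller in absolute value
than its opener. -/
def ExcNest (p q : ℤ × ℤ) : Prop :=
  0 ≤ p.1 ∧ p.2 ≤ 0 ∧ 0 ≤ q.1 ∧ q.2 ≤ 0 ∧ (|p.2| < |p.1| ∨ |q.2| < |q.1|)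

/-- A block augmented by `0` if it is the zero block. -/
def augB (B : Finset ℤ) : Finset ℤ := if negSet B = B then insert 0 B else B

/-- The arc `p` contains `n`. -/
def ContainsN (n : ℕ) (p : ℤ × ℤ) : Prop := p.1 = (n : ℤ) ∨ p.2 = (n : ℤ)

/-- The arc `p` contains `-n`. -/
def ContainsNegN (n : ℕ) (p : ℤ × ℤ) : Prop := p.1 = -(n : ℤ) ∨ p.2 = -(n : ℤ)

namespace SetPartitionC

variable {n : ℕ}

/-- The ground set `[±n]` as a finset of integers. -/
def pmn (n : ℕ) : Finset ℤ := (Finset.Icc (-(n : ℤ)) (n : ℤ)).erase 0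

/-- `(i,j)` is an arc: `i`, `j` are consecutive elements of a block in the nesting order. -/
def IsArc (P : SetPartitionC n) (i j : ℤ) : Prop :=
  nestOrd n i < nestOrd n j ∧ ∃ B ∈ P.blocks, i ∈ B ∧ j ∈ B ∧
    ∀ k ∈ B, ¬(nestOrd n i < nestOrd n k ∧ nestOrd n k < nestOrd n j)

/-- The finite set of arcs of `P` (written in nesting order). -/
def arcs (P : SetPartitionC n) : Finset (ℤ × ℤ) :=
  (pmn n ×ˢ pmn n).filter fun p => P.IsArc p.1 p.2

/-- Openers: positive elements that are not maximal in their block w.r.t. the nesting order. -/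
def openers (P : SetPartitionC n) : Finset ℤ :=
  (Finset.Icc 1 (n : ℤ)).filter fun i =>
    ∃ B ∈ P.blocks, i ∈ B ∧ ∃ j ∈ B, nestOrd n i < nestOrd n j

/-- Closers: positive elements that are not minimal in their block w.r.t. the nesting order. -/
def closers (P : SetPartitionC n) : Finset ℤ :=
  (Finset.Icc 1 (n : ℤ)).filter fun i =>
    ∃ B ∈ P.blocks, i ∈ B ∧ ∃ j ∈ B, nestOrd n j < nestOrd n i

/-- The number of crossings of a type `C` set partition. -/
def crossings (P : SetPartitionC n) : ℕ :=
  ((P.arcs ×ˢ P.arcs).filter fun q => CrossRel n q.1 q.2).card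

/-- The number of nestings of a type `C` set partition. -/
def nestings (P : SetPartitionC n) : ℕ :=
  ((P.arcs ×ˢ P.arcs).filter fun q => NestRel n q.1 q.2).card

/-- The number of crossings among pairs of arcs that both have positive opener. -/
def crossingsPos (P : SetPartitionC n) : ℕ :=
  (((P.arcs.filter fun p => 0 < p.1) ×ˢ (P.arcs.filter fun p => 0 < p.1)).filter
    fun q => CrossRel n q.1 q.2).card

/-- The number of nestings among pairs of arcs that both have positive opener. -/
def nestingsPos (P : SetPartitionC n) : ℕ :=
  (((P.arcs.filter fun p => 0 < p.1) ×ˢ (P.arcs.filter fun p => 0 < p.1)).filter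
    fun q => NestRel n q.1 q.2).card

/-- The cardinality of a maximal crossing. -/
def maxCrossing (P : SetPartitionC n) : ℕ :=
  (P.arcs.powerset.filter fun S => ∀ a ∈ S, ∀ b ∈ S, a ≠ b → Crosses n a b).sup Finset.card

/-- The cardinality of a maximal nesting. -/
def maxNesting (P : SetPartitionC n) : ℕ :=
  (P.arcs.powerset.filter fun S => ∀ a ∈ S, ∀ b ∈ S, a ≠ b → Nests n a b).sup Finset.card

/-! ### Type B notions -/

/-- `(i,j)` is a type `B` nesting arc: consecutive elements of an augmented block in the
type `B` nesting order. -/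
def IsArcB (P : SetPartitionC n) (i j : ℤ) : Prop :=
  nestOrdB n i < nestOrdB n j ∧ ∃ B ∈ P.blocks, i ∈ augB B ∧ j ∈ augB B ∧
    ∀ k ∈ augB B, ¬(nestOrdB n i < nestOrdB n k ∧ nestOrdB n k < nestOrdB n j)

/-- The finite set of type `B` nesting arcs of `P`. -/
def arcsB (P : SetPartitionC n) : Finset (ℤ × ℤ) :=
  ((insert 0 (pmn n)) ×ˢ (insert 0 (pmn n))).filter fun p => P.IsArcB p.1 p.2

/-- The number of type `B` crossings. -/
def crossingsB (P : SetPartitionC n) : ℕ :=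
  ((P.arcs ×ˢ P.arcs).filter fun q => CrossRel n q.1 q.2 ∧ ¬ExcCross q.1 q.2).card

/-- The number of type `B` nestings. -/
def nestingsB (P : SetPartitionC n) : ℕ :=
  ((P.arcsB ×ˢ P.arcsB).filter fun q => NestRelB n q.1 q.2 ∧ ¬ExcNest q.1 q.2).card

/-- Openers in type `B`: positive elements not maximal in their block
w.r.t. the type `B` nesting order. -/
def openersB (P : SetPartitionC n) : Finset ℤ :=
  (Finset.Icc 1 (n : ℤ)).filter fun i =>
    ∃ B ∈ P.blocks, i ∈ B ∧ ∃ j ∈ B, nestOrdB n i < nestOrdB n j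

/-- Closers in type `B`: positive elements not minimal in their block
w.r.t. the type `B` nesting order. -/
def closersB (P : SetPartitionC n) : Finset ℤ :=
  (Finset.Icc 1 (n : ℤ)).filter fun i =>
    ∃ B ∈ P.blocks, i ∈ B ∧ ∃ j ∈ B, nestOrdB n j < nestOrdB n i

/-- The cardinality of a maximal type `B` crossing. -/
def maxCrossingB (P : SetPartitionC n) : ℕ :=
  (P.arcs.powerset.filter fun S =>
    ∀ a ∈ S, ∀ b ∈ S, a ≠ b → Crosses n a b ∧ ¬ExcCross a b).sup Finset.card

/-- The cardinality of a maximal type `B` nesting. -/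
def maxNestingB (P : SetPartitionC n) : ℕ :=
  (P.arcsB.powerset.filter fun S =>
    ∀ a ∈ S, ∀ b ∈ S, a ≠ b → NestsB n a b ∧ ¬ExcNest a b).sup Finset.card

/-! ### Type D notions -/

/-- A type `C` set partition is of type `D` if the zero block, when present, is not a single
pair `{i,-i}`. -/
def IsTypeD (P : SetPartitionC n) : Prop :=
  ∀ B ∈ P.blocks, negSet B = B → B.card ≠ 2

/-- The arcs starting in `{1,…,n-1}` and ending in the negative of an element of `{1,…,n-1}`. -/
def pnArcs (P : SetPartitionC n) : Finset (ℤ × ℤ) :=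
  P.arcs.filter fun p => 0 < p.1 ∧ p.1 < (n : ℤ) ∧ -(n : ℤ) < p.2 ∧ p.2 < 0

/-- The index `l` of an arc `a = (i_l, -j_l)` in the list of `pnArcs` ordered by openers. -/
def dRank (P : SetPartitionC n) (a : ℤ × ℤ) : ℕ :=
  (P.pnArcs.filter fun b => b.1 ≤ a.1).card

/-- The crossings allowed in a non-crossing set partition of type `D`. -/
def AllowedCrossD (P : SetPartitionC n) (p q : ℤ × ℤ) : Prop :=
  (ContainsN n p ∧ q ∈ P.pnArcs ∧ P.pnArcs.card < 2 * P.dRank q) ∨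
  (ContainsN n q ∧ p ∈ P.pnArcs ∧ P.pnArcs.card < 2 * P.dRank p) ∨
  (ContainsNegN n p ∧ q ∈ P.pnArcs ∧ 2 * P.dRank q ≤ P.pnArcs.card) ∨
  (ContainsNegN n q ∧ p ∈ P.pnArcs ∧ 2 * P.dRank p ≤ P.pnArcs.card) ∨
  (ContainsN n p ∧ ContainsNegN n q) ∨
  (ContainsN n q ∧ ContainsNegN n p)

/-- `P` is a non-crossing set partition of type `D_n`. -/
def NonCrossingD (P : SetPartitionC n) : Prop :=
  (∀ i : ℤ, 0 < i → P.IsArc i (-i) → i = n) ∧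
  (∀ p ∈ P.arcs, ∀ q ∈ P.arcs, Crosses n p q → P.AllowedCrossD p q) ∧
  (∀ p ∈ P.arcs, ContainsN n p →
    ∀ q ∈ P.pnArcs, P.pnArcs.card < 2 * P.dRank q → Crosses n p q) ∧
  (∀ p ∈ P.arcs, ContainsNegN n p →
    ∀ q ∈ P.pnArcs, 2 * P.dRank q ≤ P.pnArcs.card → Crosses n p q)

/-- The nestings (`p` over `q`) allowed in a non-nesting set partition of type `D`. -/
def AllowedNestD (P : SetPartitionC n) (p q : ℤ × ℤ) : Prop :=
  (0 < p.1 ∧ p.1 < q.1 ∧ q.1 < (n : ℤ) ∧ p.2 = -(n : ℤ) ∧ q.2 = (n : ℤ)) ∨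
  (q.1 = (n : ℤ) ∧ q.2 = -(n : ℤ) ∧ 0 < p.1 ∧ p.1 < (n : ℤ) ∧ -(n : ℤ) < p.2 ∧ p.2 < 0 ∧
    ∃ m : ℤ, 0 < m ∧ m < p.1 ∧ m < -p.2 ∧ P.IsArc m (n : ℤ))

/-- `P` is a non-nesting set partition of type `D_n`. -/
def NonNestingD (P : SetPartitionC n) : Prop :=
  (∀ i : ℤ, 0 < i → P.IsArc i (-i) → i = n) ∧
  (∀ p ∈ P.arcs, ∀ q ∈ P.arcs, NestRel n p q → P.AllowedNestD p q)

end SetPartitionC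

/-! ### The staircase polyomino and chains in fillings -/

/-- The cells of the staircase polyomino `P_n`: `(c,r)` with `1 ≤ c ≤ n`, `c ≤ r ≤ 2n-1`. -/
def cellsP (n : ℕ) : Finset (ℕ × ℕ) :=
  ((Finset.Icc 1 n) ×ˢ (Finset.Icc 1 (2 * n - 1))).filter fun p => p.1 ≤ p.2

/-- The length of the longest north-east chain among a set of (nonzero) cells:
columns strictly increase while rows strictly decrease. -/
def neLen (S : Finset (ℕ × ℕ)) : ℕ :=
  (S.powerset.filter fun T =>
    ∀ a ∈ T, ∀ b ∈ T, a ≠ b →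
      (a.1 < b.1 ∧ b.2 < a.2) ∨ (b.1 < a.1 ∧ a.2 < b.2)).sup Finset.card

/-- The length of the longest south-east chain among a set of (nonzero) cells:
columns and rows strictly increase, and the surrounding rectangle lies in the polyomino
(`a.1 ≤ b.2` for all cells `a`, `b` of the chain). -/
def seLen (S : Finset (ℕ × ℕ)) : ℕ :=
  (S.powerset.filter fun T =>
    (∀ a ∈ T, ∀ b ∈ T, a ≠ b →
      (a.1 < b.1 ∧ a.2 < b.2) ∨ (b.1 < a.1 ∧ b.2 < a.2)) ∧
    ∀ a ∈ T, ∀ b ∈ T, a.1 ≤ b.2).sup Finset.card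

namespace SetPartitionC

variable {n : ℕ}

/-- The cells filled with `1` in the nesting filling of the staircase polyomino: rows are
labelled from top to bottom by `2,…,n,-n,…,-1`; the cell in column `i` and row labelled `j`
is filled iff `(i,j)` is an arc with positive opener `i`. -/
def nestFill (P : SetPartitionC n) : Finset (ℕ × ℕ) :=
  (cellsP n).filter fun c => ∃ j : ℤ, P.IsArc (c.1 : ℤ) j ∧ nestOrd n j = (c.2 : ℤ) + 1

/-- The cells filled with `1` in the crossing filling of the staircase polyomino: rows are
labelled from top to bottom by `2,…,n,-1,…,-n`; the cell in column `i` and row labelled `j`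
is filled iff `(i,j)` is an arc with positive opener `i`. -/
def crossFill (P : SetPartitionC n) : Finset (ℕ × ℕ) :=
  (cellsP n).filter fun c => ∃ j : ℤ, P.IsArc (c.1 : ℤ) j ∧ crossOrd n j = (c.2 : ℤ) + 1

end SetPartitionC

/-! ### Triangulations of the symmetric 2n-gon and symmetric fans of Dyck paths -/

/-- `p` is a diagonal of the `2n`-gon with vertices labelled by `[±n]`, written with its two
(distinct) endpoints in crossing order. -/
def IsDiag (n : ℕ) (p : ℤ × ℤ) : Prop :=
  p.1 ≠ 0 ∧ p.2 ≠ 0 ∧ |p.1| ≤ (n : ℤ) ∧ |p.2| ≤ (n : ℤ) ∧ crossOrd n p.1 < crossOrd n p.2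

/-- Normalize a pair so that its endpoints are in crossing order. -/
def normD (n : ℕ) (p : ℤ × ℤ) : ℤ × ℤ :=
  if crossOrd n p.1 < crossOrd n p.2 then p else (p.2, p.1)

/-- `ω` contains `m` mutually crossing diagonals. -/
def HasMCross (n m : ℕ) (ω : Finset (ℤ × ℤ)) : Prop :=
  ∃ S ⊆ ω, S.card = m ∧ ∀ a ∈ S, ∀ b ∈ S, a ≠ b → Crosses n a b

/-- A type `C_n` `k`-triangulation: a symmetric set of diagonals with no `(k+1)`-crossing,
maximal with this property. -/
def IsTriangC (n k : ℕ) (ω : Finset (ℤ × ℤ)) : Prop :=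
  (∀ p ∈ ω, IsDiag n p) ∧
  (∀ p ∈ ω, normD n (-p.1, -p.2) ∈ ω) ∧
  ¬HasMCross n (k + 1) ω ∧
  ∀ d : ℤ × ℤ, IsDiag n d → d ∉ ω → HasMCross n (k + 1) (insert d ω)

/-- A Dyck path in the staircase polyomino starting at the top cell `(i,i)` of column `i`,
proceeding by unit south or west steps inside `P_n`, and ending on the main diagonal
`r = 2n - c`. -/
def IsDyckPath (n i : ℕ) (l : List (ℕ × ℕ)) : Prop :=
  l ≠ [] ∧ l.head? = some (i, i) ∧ (∀ c ∈ l, c ∈ cellsP n) ∧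
  l.Chain' (fun a b => (b.1 = a.1 ∧ b.2 = a.2 + 1) ∨ (b.1 + 1 = a.1 ∧ b.2 = a.2)) ∧
  ∀ c : ℕ × ℕ, l.getLast? = some c → c.2 = 2 * n - c.1

/-- A symmetric fan of `k` non-intersecting Dyck paths: the `i`-th path starts at cell
`(i,i)` and the paths are pairwise cell-disjoint. -/
def IsSymFan (n k : ℕ) (f : Fin k → List (ℕ × ℕ)) : Prop :=
  (∀ i : Fin k, IsDyckPath n ((i : ℕ) + 1) (f i)) ∧
  ∀ i j : Fin k, i ≠ j → ∀ c ∈ f i, c ∉ f j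

namespace MaxFill

/-- swap the entries in positions `l`, `l+1` -/
def swp (u : ℕ → ℕ) (l : ℕ) : ℕ → ℕ :=
  fun j => if j = l then u (l+1) else if j = l+1 then u l else u j

def stp (b : Prop) (u : ℕ → ℕ) (l : ℕ) : ℕ → ℕ :=
  if b ∧ u (l+1) < u l then swp u l else u

def rk (u : ℕ → ℕ) (V P : ℕ) : ℕ := ((Finset.range (P+1)).filter (fun j => u j ≤ V)).card

lemma rk_succ (u : ℕ → ℕ) (V P : ℕ) :
    rk u V (P+1) = rk u V P + if u (P+1) ≤ V then 1 else 0 := by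
  unfold rk
  rw [Finset.range_add_one (n := P+1), Finset.filter_insert]
  split_ifs with h
  · rw [Finset.card_insert_of_notMem (by simp)]
  · simp

lemma rk_zero (u : ℕ → ℕ) (V : ℕ) :
    rk u V 0 = if u 0 ≤ V then 1 else 0 := by
  unfold rk
  split_ifs with h <;> simp [Finset.filter_singleton, h]

lemma rk_congr (u v : ℕ → ℕ) (V P : ℕ) (h : ∀ j ≤ P, u j = v j) : rk u V P = rk v V P := by
  unfold rk
  congr 1
  apply Finset.filter_congr
  intro j hj
  rw [h j (by simpa [Nat.lt_succ_iff] using hj)]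

lemma rk_swp (u : ℕ → ℕ) (V l P : ℕ) (hl : 1 ≤ l) (h : P ≠ l) : rk (swp u l) V P = rk u V P := by
  rcases Nat.lt_or_gt_of_ne h with h | h
  · apply rk_congr
    intro j hj
    simp only [swp]
    rw [if_neg (by omega), if_neg (by omega)]
  · obtain ⟨d, rfl⟩ : ∃ d, P = l + 1 + d := ⟨P - (l+1), by omega⟩
    clear h
    induction d with
    | zero =>
      obtain ⟨m, rfl⟩ : ∃ m, l = m + 1 := ⟨l - 1, by omega⟩
      have e : rk (swp u (m+1)) V m = rk u V m := by
        apply rk_congr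
        intro j hj
        simp only [swp]
        rw [if_neg (by omega), if_neg (by omega)]
      simp only [add_zero]
      rw [rk_succ, rk_succ, rk_succ, rk_succ, e]
      simp only [swp]
      simp
      omega
    | succ d ih =>
      have e : swp u l (l + 1 + d + 1) = u (l + 1 + d + 1) := by
        unfold swp
        rw [if_neg (by omega), if_neg (by omega)]
      rw [← add_assoc, rk_succ, rk_succ, ih (by omega)]
      simp only [e]

lemma rk_stp_ne (b : Prop) (u : ℕ → ℕ) (V l P : ℕ) (hl : 1 ≤ l) (h : P ≠ l) :
    rk (stp b u l) V P = rk u V P := by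
  unfold stp
  split_ifs
  · exact rk_swp u V l P hl h
  · rfl

lemma rk_stp_eq (b : Prop) (u : ℕ → ℕ) (V l : ℕ) (hl : 1 ≤ l) :
    rk (stp b u l) V l =
      if b then min (rk u V (l-1) + 1) (rk u V (l+1)) else rk u V l := by
  obtain ⟨m, rfl⟩ : ∃ m, l = m + 1 := ⟨l - 1, by omega⟩
  unfold stp
  by_cases hb : b
  · simp only [hb, true_and, if_true, Nat.add_sub_cancel]
    split_ifs with h
    · have e : rk (swp u (m+1)) V m = rk u V m := by
        apply rk_congr
        intro j hj
        simp only [swp]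
        rw [if_neg (by omega), if_neg (by omega)]
      rw [rk_succ, e, rk_succ, rk_succ]
      simp only [swp, if_true]
      split_ifs <;> omega
    · have e1 := rk_succ u V m
      have e2 := rk_succ u V (m+1)
      split_ifs at e1 e2 <;> omega
  · simp [hb]

lemma rk_mono (u : ℕ → ℕ) (V : ℕ) : Monotone (rk u V) := by
  apply monotone_nat_of_le_succ
  intro P
  rw [rk_succ]; omega

lemma rk_succ_le (u : ℕ → ℕ) (V P : ℕ) : rk u V (P+1) ≤ rk u V P + 1 := by
  rw [rk_succ]; split_ifs <;> omega

variable {α : Type*}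

def proc (lt : α → ℕ) (C : Finset α) : List α → (ℕ → ℕ) → (ℕ → ℕ)
  | [], u => u
  | p :: L, u => proc lt C L (stp (p ∈ C) u (lt p))

lemma proc_append (lt : α → ℕ) (C : Finset α) (L L' : List α) (u : ℕ → ℕ) :
    proc lt C (L ++ L') u = proc lt C L' (proc lt C L u) := by
  induction L generalizing u with
  | nil => rfl
  | cons p L ih => simp [proc, ih]

/-- one row: cells `cell 0, cell 1, ...` with letters `hi, hi-1, ...` -/
lemma row_rk (lt : α → ℕ) (C : Finset α) (cell : ℕ → α) (hi t : ℕ) (ht : t ≤ hi)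
    (hlt : ∀ s < t, lt (cell s) = hi - s) (u : ℕ → ℕ) (V : ℕ) :
    (∀ P, P ≤ hi - t → rk (proc lt C ((List.range t).map cell) u) V P = rk u V P) ∧
    (∀ P, hi < P → rk (proc lt C ((List.range t).map cell) u) V P = rk u V P) ∧
    (∀ s < t, rk (proc lt C ((List.range t).map cell) u) V (hi - s) =
      if cell s ∈ C then min (rk u V (hi - s - 1) + 1)
        (rk (proc lt C ((List.range t).map cell) u) V (hi - s + 1)) else rk u V (hi - s)) := by
  induction t with
  | zero => simp [proc]
  | succ t ih =>
    obtain ⟨i1, i2, i3⟩ := ih (by omega) (fun s hs => hlt s (by omega))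
    rw [List.range_succ, List.map_append, proc_append]
    set v := proc lt C ((List.range t).map cell) u with hv
    simp only [List.map_cons, List.map_nil, proc]
    have hl := hlt t (by omega)
    rw [hl]
    refine ⟨?_, ?_, ?_⟩
    · intro P hP
      rw [rk_stp_ne _ _ _ _ _ (by omega) (by omega)]
      exact i1 P (by omega)
    · intro P hP
      rw [rk_stp_ne _ _ _ _ _ (by omega) (by omega)]
      exact i2 P (by omega)
    · intro s hs
      rcases Nat.lt_succ_iff_lt_or_eq.mp hs with h | h
      · rw [rk_stp_ne _ _ _ _ _ (by omega) (by omega),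
          rk_stp_ne _ _ _ _ _ (by omega) (by omega)]
        exact i3 s h
      · subst h
        rw [rk_stp_eq _ _ _ _ (by omega), rk_stp_ne _ _ _ _ _ (by omega) (by omega),
          i1 (hi - s - 1) (by omega), i1 (hi - s) (by omega)]
        congr

/-- rows `1..y` -/
def rowsL (cell : ℕ → ℕ → α) (len : ℕ → ℕ) (y : ℕ) : List α :=
  (List.range y).flatMap (fun i => (List.range (len (i+1))).map (cell (i+1)))

lemma rowsL_succ (cell : ℕ → ℕ → α) (len : ℕ → ℕ) (y : ℕ) :
    rowsL cell len (y+1) = rowsL cell len y ++ (List.range (len (y+1))).map (cell (y+1)) := by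
  simp [rowsL, List.range_succ]

/-- abstract rank tables -/
structure Tab (rr : ℕ → ℕ → ℕ) (Cc : ℕ → ℕ → Prop) (n : ℕ) : Prop where
  mono : ∀ y P Q, P ≤ Q → rr y P ≤ rr y Q
  lip : ∀ y P, rr y (P+1) ≤ rr y P + 1
  rec1 : ∀ y P, y + 1 ≤ n → Cc (y+1) (P+1) →
    rr (y+1) (P+1) = min (rr y P + 1) (rr (y+1) (P+2))
  rec0 : ∀ y P, y + 1 ≤ n → ¬ Cc (y+1) P → rr (y+1) P = rr y P

lemma Tab.step_le {rr : ℕ → ℕ → ℕ} {Cc : ℕ → ℕ → Prop} {n : ℕ} (h : Tab rr Cc n) (y P : ℕ)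
    (hy : y + 1 ≤ n) : rr (y+1) (P+1) ≤ rr y P + 1 := by
  by_cases hc : Cc (y+1) (P+1)
  · rw [h.rec1 y P hy hc]; exact min_le_left _ _
  · rw [h.rec0 y _ hy hc]; exact h.lip y P

/-- chains in coordinates (row, x): rows increase, x decreases -/
def ChainT (T : Finset (ℕ × ℕ)) : Prop :=
  ∀ a ∈ T, ∀ b ∈ T, a ≠ b → (a.1 < b.1 ∧ b.2 < a.2) ∨ (b.1 < a.1 ∧ a.2 < b.2)

lemma Tab.upper {rr : ℕ → ℕ → ℕ} {Cc : ℕ → ℕ → Prop} {n : ℕ} (h : Tab rr Cc n) (q : ℕ) :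
    ∀ p ≤ n, ∀ x0 ≤ q, ∀ T : Finset (ℕ × ℕ), ChainT T →
      (∀ a ∈ T, 1 ≤ a.1 ∧ a.1 ≤ p ∧ x0 < a.2 ∧ a.2 ≤ q ∧ ¬ Cc a.1 (a.1 + a.2 - 1)) →
      rr p (p + x0) + T.card ≤ rr 0 q + p := by
  intro p
  induction p with
  | zero =>
    intro _ x0 hx T _ hT
    have : T = ∅ := by
      apply Finset.eq_empty_of_forall_notMem
      intro a ha
      have := hT a ha
      omega
    subst this
    simpa using h.mono 0 x0 q hx
  | succ p ih =>
    intro hp x0 hx T hch hT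
    by_cases hex : ∃ a ∈ T, a.1 = p + 1
    · obtain ⟨a, ha, ha1⟩ := hex
      have hTa := hT a ha
      have h1 := ih (by omega) a.2 hTa.2.2.2.1 (T.erase a)
        (fun b hb c hc => hch b (Finset.mem_of_mem_erase hb) c (Finset.mem_of_mem_erase hc))
        (by
          intro b hb
          have hbT := Finset.mem_of_mem_erase hb
          have hne := Finset.ne_of_mem_erase hb
          have := hT b hbT
          have h3 := hch b hbT a ha hne
          refine ⟨this.1, by omega, by omega, this.2.2.2.1, this.2.2.2.2⟩)
      rw [Finset.card_erase_of_mem ha] at h1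
      have hc0 : 0 < T.card := Finset.card_pos.mpr ⟨a, ha⟩
      have hnc := hTa.2.2.2.2
      rw [ha1, show p + 1 + a.2 - 1 = p + a.2 by omega] at hnc
      have h2 := h.rec0 p (p + a.2) hp hnc
      have h3 := h.mono (p+1) (p + 1 + x0) (p + a.2) (by omega)
      omega
    · push Not at hex
      have h1 := ih (by omega) x0 hx T hch (by
          intro b hb
          have := hT b hb
          have := hex b hb
          refine ⟨by omega, by omega, by omega, by omega, by tauto⟩)
      have h2 := h.step_le p (p + x0) hp
      rw [show p + x0 + 1 = p + 1 + x0 by omega] at h2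
      omega

lemma Tab.lower {rr : ℕ → ℕ → ℕ} {Cc : ℕ → ℕ → Prop} {n : ℕ} (h : Tab rr Cc n)
    (hi : ℕ → ℕ) (hhi : ∀ y P, hi y < P → ¬ Cc y P) :
    ∀ y ≤ n, ∀ x0, ∃ q, ∃ T : Finset (ℕ × ℕ), ChainT T ∧ x0 ≤ q ∧
      (∀ a ∈ T, 1 ≤ a.1 ∧ a.1 ≤ y ∧ x0 < a.2 ∧ a.2 ≤ q ∧ ¬ Cc a.1 (a.1 + a.2 - 1)) ∧
      rr 0 q + y ≤ rr y (y + x0) + T.card := by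
  intro y
  induction y with
  | zero =>
    intro _ x0
    exact ⟨x0, ∅, by simp [ChainT], le_rfl, by simp, by simp⟩
  | succ y ih =>
    intro hy
    -- inner induction on the distance to `hi`
    have key : ∀ d x0, hi (y+1) + 1 ≤ y + 1 + x0 + d → ∃ q, ∃ T : Finset (ℕ × ℕ), ChainT T ∧ x0 ≤ q ∧
      (∀ a ∈ T, 1 ≤ a.1 ∧ a.1 ≤ y+1 ∧ x0 < a.2 ∧ a.2 ≤ q ∧ ¬ Cc a.1 (a.1 + a.2 - 1)) ∧
      rr 0 q + (y+1) ≤ rr (y+1) (y + 1 + x0) + T.card := by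
      intro d
      have elbow : ∀ x0, ¬ Cc (y+1) (y + 1 + x0) → ∃ q, ∃ T : Finset (ℕ × ℕ), ChainT T ∧ x0 ≤ q ∧
          (∀ a ∈ T, 1 ≤ a.1 ∧ a.1 ≤ y+1 ∧ x0 < a.2 ∧ a.2 ≤ q ∧ ¬ Cc a.1 (a.1 + a.2 - 1)) ∧
          rr 0 q + (y+1) ≤ rr (y+1) (y + 1 + x0) + T.card := by
        intro x0 hc
        obtain ⟨q, T, hT, hq, hT2, hr⟩ := ih (by omega) (x0+1)
        have hnot : (y+1, x0+1) ∉ T := by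
          intro hm
          have := hT2 _ hm
          omega
        refine ⟨q, insert (y+1, x0+1) T, ?_, by omega, ?_, ?_⟩
        · intro a ha b hb hab
          rw [Finset.mem_insert] at ha hb
          rcases ha with rfl | ha <;> rcases hb with rfl | hb
          · exact absurd rfl hab
          · have := hT2 b hb
            right; constructor <;> simp only <;> omega
          · have := hT2 a ha
            left; constructor <;> simp only <;> omega
          · exact hT a ha b hb hab
        · intro a ha
          rw [Finset.mem_insert] at ha
          rcases ha with rfl | ha
          · refine ⟨by simp, by simp, by simp, by simpa using hq, ?_⟩
            simp only
            rw [show y + 1 + (x0 + 1) - 1 = y + 1 + x0 by omega]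
            exact hc
          · have := hT2 a ha
            refine ⟨by omega, by omega, by omega, by omega, by tauto⟩
        · rw [Finset.card_insert_of_notMem hnot, h.rec0 y _ hy hc]
          rw [show y + (x0 + 1) = y + 1 + x0 by omega] at hr
          omega
      induction d with
      | zero =>
        intro x0 hd
        exact elbow x0 (hhi _ _ (by omega))
      | succ d ihd =>
        intro x0 hd
        by_cases hc : Cc (y+1) (y + 1 + x0)
        · have hrec := h.rec1 y (y + x0) hy (by rw [show y + x0 + 1 = y + 1 + x0 by omega]; exact hc)
          rw [show y + x0 + 1 = y + 1 + x0 by omega] at hrec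
          rcases le_total (rr y (y + x0) + 1) (rr (y + 1) (y + x0 + 2)) with hle | hle
          · rw [min_eq_left hle] at hrec
            obtain ⟨q, T, hT, hq, hT2, hr⟩ := ih (by omega) x0
            refine ⟨q, T, hT, hq, ?_, by omega⟩
            intro a ha
            have := hT2 a ha
            refine ⟨by omega, by omega, by omega, by omega, by tauto⟩
          · rw [min_eq_right hle] at hrec
            obtain ⟨q, T, hT, hq, hT2, hr⟩ := ihd (x0+1) (by omega)
            refine ⟨q, T, hT, by omega, ?_, ?_⟩
            · intro a ha
              have := hT2 a ha
              refine ⟨by omega, by omega, by omega, by omega, by tauto⟩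
            · rw [hrec]
              rw [show y + 1 + (x0 + 1) = y + x0 + 2 by omega] at hr
              exact hr
        · exact elbow x0 hc
    intro x0
    exact key (hi (y+1) + 1) x0 (by omega)

/-- The table attached to a process. -/
lemma tab_proc (lt : α → ℕ) (C : Finset α) (cell : ℕ → ℕ → α) (len hi : ℕ → ℕ) (n : ℕ)
    (hlen : ∀ y, 1 ≤ y → y ≤ n → len y ≤ hi y)
    (hlt : ∀ y, 1 ≤ y → y ≤ n → ∀ s < len y, lt (cell y s) = hi y - s) (w : ℕ → ℕ) (V : ℕ) :
    Tab (fun y P => rk (proc lt C (rowsL cell len y) w) V P)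
      (fun y P => P ≤ hi y ∧ hi y - P < len y ∧ cell y (hi y - P) ∈ C) n where
  mono := fun y P Q h => rk_mono _ _ h
  lip := fun y P => rk_succ_le _ _ _
  rec1 := by
    intro y P hy hc
    rw [rowsL_succ, proc_append]
    have := (row_rk lt C (cell (y+1)) (hi (y+1)) (len (y+1)) (hlen _ (by omega) hy)
      (hlt _ (by omega) hy) (proc lt C (rowsL cell len y) w) V).2.2 (hi (y+1) - (P+1)) hc.2.1
    rw [if_pos hc.2.2] at this
    rw [show hi (y+1) - (hi (y+1) - (P+1)) = P + 1 by have := hc.1; omega] at this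
    exact this
  rec0 := by
    intro y P hy hc
    rw [rowsL_succ, proc_append]
    have := (row_rk lt C (cell (y+1)) (hi (y+1)) (len (y+1)) (hlen _ (by omega) hy)
      (hlt _ (by omega) hy) (proc lt C (rowsL cell len y) w) V)
    by_cases h1 : hi (y+1) < P
    · exact this.2.1 P h1
    by_cases h2 : P ≤ hi (y+1) - len (y+1)
    · exact this.1 P h2
    have h3 := this.2.2 (hi (y+1) - P) (by have := hlen (y+1) (by omega) hy; omega)
    rw [if_neg (by
      intro hm; apply hc
      exact ⟨by omega, by have := hlen (y+1) (by omega) hy; omega, hm⟩)] at h3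
    rw [show hi (y+1) - (hi (y+1) - P) = P by omega] at h3
    exact h3

end MaxFill

namespace MaxFill
variable {α : Type*}

def ValidW (lt : α → ℕ) (S : Finset α) : List α → (ℕ → ℕ) → Prop
  | [], u => u = id
  | p :: L, u => (p ∈ S → u (lt p + 1) < u (lt p) ∧ ValidW lt S L (swp u (lt p))) ∧
      (p ∉ S → ValidW lt S L u)

lemma ValidW.congr (lt : α → ℕ) (S S' : Finset α) (L : List α) (u : ℕ → ℕ)
    (h : ∀ p ∈ L, p ∈ S ↔ p ∈ S') : ValidW lt S L u ↔ ValidW lt S' L u := by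
  induction L generalizing u with
  | nil => simp [ValidW]
  | cons p L ih =>
    have h1 := h p (by simp)
    have h2 : ∀ q ∈ L, q ∈ S ↔ q ∈ S' := fun q hq => h q (by simp [hq])
    simp only [ValidW, h1, ih _ h2]

lemma ValidW.proc (lt : α → ℕ) (S : Finset α) (L : List α) (u : ℕ → ℕ)
    (h : ValidW lt S L u) : proc lt S L u = id := by
  induction L generalizing u with
  | nil => exact h
  | cons p L ih =>
    simp only [MaxFill.proc, stp]
    by_cases hp : p ∈ S
    · have := h.1 hp
      rw [if_pos ⟨hp, this.1⟩]
      exact ih _ this.2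
    · rw [if_neg (by tauto)]
      exact ih _ (h.2 hp)

lemma exists_valid (lt : α → ℕ) (C : Finset α) (L : List α) (hL : L.Nodup) (u : ℕ → ℕ)
    (h : proc lt C L u = id) : ∃ S ⊆ C, S ⊆ L.toFinset ∧ ValidW lt S L u := by
  induction L generalizing u with
  | nil => exact ⟨∅, by simp, by simp, h⟩
  | cons p L ih =>
    rw [List.nodup_cons] at hL
    simp only [proc, stp] at h
    by_cases hp : p ∈ C ∧ u (lt p + 1) < u (lt p)
    · rw [if_pos hp] at h
      obtain ⟨S, h1, h2, h3⟩ := ih hL.2 _ h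
      refine ⟨insert p S, ?_, ?_, ?_⟩
      · exact Finset.insert_subset hp.1 h1
      · intro x hx
        simp only [Finset.mem_insert, List.toFinset_cons] at hx ⊢
        exact hx.imp_right (fun h => h2 h)
      · refine ⟨fun _ => ⟨hp.2, ?_⟩, fun h => absurd (Finset.mem_insert_self _ _) h⟩
        rw [ValidW.congr lt _ S]
        · exact h3
        · intro q hq
          simp only [Finset.mem_insert, or_iff_right_iff_imp]
          rintro rfl
          exact absurd hq hL.1
    · rw [if_neg hp] at h
      obtain ⟨S, h1, h2, h3⟩ := ih hL.2 _ h
      refine ⟨S, h1, ?_, ?_⟩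
      · intro x hx
        simp only [Finset.mem_insert, List.toFinset_cons]
        exact Or.inr (h2 hx)
      · refine ⟨fun hpS => ?_, fun _ => h3⟩
        exact absurd (List.mem_toFinset.1 (h2 hpS)) hL.1

def inv (K : ℕ) (u : ℕ → ℕ) : ℕ :=
  ((Finset.range K ×ˢ Finset.range K).filter fun p => p.1 < p.2 ∧ u p.2 < u p.1).card

def sig (l j : ℕ) : ℕ := if j = l then l+1 else if j = l+1 then l else j

lemma swp_sig (u : ℕ → ℕ) (l j : ℕ) : swp u l j = u (sig l j) := by
  unfold swp sig; split_ifs <;> rfl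

lemma sig_sig (l j : ℕ) : sig l (sig l j) = j := by
  unfold sig; split_ifs <;> omega

lemma sig_lt (K l j : ℕ) (hl : l + 1 < K) (h : j < K) : sig l j < K := by
  unfold sig; split_ifs <;> omega

lemma sig_lt_sig (l a b : ℕ) (h : a < b) (h2 : ¬ (a = l ∧ b = l+1)) : sig l a < sig l b := by
  unfold sig; split_ifs <;> omega

lemma inv_swp (K : ℕ) (u : ℕ → ℕ) (l : ℕ) (hl : l + 1 < K) (hd : u (l+1) < u l) :
    inv K u = inv K (swp u l) + 1 := by
  unfold inv
  have hmem : (l, l+1) ∈ (Finset.range K ×ˢ Finset.range K).filter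
      fun p => p.1 < p.2 ∧ u p.2 < u p.1 := by
    simp; exact ⟨⟨by omega, hl⟩, hd⟩
  rw [← Finset.card_erase_add_one hmem]
  congr 1
  apply Finset.card_bij (fun p _ => (sig l p.1, sig l p.2))
  · rintro ⟨a, b⟩ h
    simp only [Finset.mem_erase, Finset.mem_filter, Finset.mem_product, Finset.mem_range, ne_eq,
      Prod.mk.injEq] at h ⊢
    refine ⟨⟨sig_lt _ _ _ hl h.2.1.1, sig_lt _ _ _ hl h.2.1.2⟩, sig_lt_sig _ _ _ h.2.2.1 h.1, ?_⟩
    rw [swp_sig, swp_sig, sig_sig, sig_sig]; exact h.2.2.2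
  · rintro ⟨a, b⟩ h ⟨c, d⟩ h' e
    simp only [Prod.mk.injEq] at e ⊢
    have e1 := congrArg (sig l) e.1
    have e2 := congrArg (sig l) e.2
    simp only [sig_sig] at e1 e2
    exact ⟨e1, e2⟩
  · rintro ⟨a, b⟩ h
    simp only [Finset.mem_filter, Finset.mem_product, Finset.mem_range] at h
    rw [swp_sig, swp_sig] at h
    have hne : ¬ (a = l ∧ b = l+1) := by
      rintro ⟨rfl, rfl⟩
      have := h.2.2
      simp [sig] at this
      omega
    refine ⟨(sig l a, sig l b), ?_, by simp [sig_sig]⟩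
    simp only [Finset.mem_erase, Finset.mem_filter, Finset.mem_product, Finset.mem_range, ne_eq,
      Prod.mk.injEq]
    refine ⟨?_, ⟨sig_lt _ _ _ hl h.1.1, sig_lt _ _ _ hl h.1.2⟩, sig_lt_sig _ _ _ h.2.1 hne, h.2.2⟩
    rintro ⟨e1, e2⟩
    have e1 := congrArg (sig l) e1
    have e2 := congrArg (sig l) e2
    rw [sig_sig] at e1 e2
    simp [sig] at e1 e2
    have := h.2.1
    omega

lemma ValidW.card (lt : α → ℕ) (K : ℕ) (L : List α) (hL : L.Nodup) (S : Finset α)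
    (hS : S ⊆ L.toFinset) (hK : ∀ p ∈ L, lt p + 1 < K) (u : ℕ → ℕ) (h : ValidW lt S L u) :
    S.card = inv K u := by
  induction L generalizing u S with
  | nil =>
    have : S = ∅ := by simpa using hS
    have hu : u = id := h
    subst this
    simp only [Finset.card_empty, inv, hu]
    symm
    rw [Finset.card_eq_zero, Finset.filter_eq_empty_iff]
    intro x _
    simp only [id]; omega
  | cons p L ih =>
    rw [List.nodup_cons] at hL
    by_cases hp : p ∈ S
    · have h1 := h.1 hp
      rw [inv_swp K u _ (hK p (by simp)) h1.1, ← Finset.card_erase_add_one hp]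
      congr 1
      apply ih hL.2 _ _ (fun q hq => hK q (by simp [hq]))
      · rw [ValidW.congr lt _ S]
        · exact h1.2
        · intro q hq
          simp only [Finset.mem_erase, and_iff_right_iff_imp]
          rintro _ rfl
          exact hL.1 hq
      · intro x hx
        have h2 := hS (Finset.mem_of_mem_erase hx)
        simp only [List.toFinset_cons, Finset.mem_insert] at h2
        exact h2.resolve_left (Finset.ne_of_mem_erase hx)
    · apply ih hL.2 _ _ (fun q hq => hK q (by simp [hq])) _ (h.2 hp)
      intro x hx
      have h2 := hS hx
      simp only [List.toFinset_cons, Finset.mem_insert] at h2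
      refine h2.resolve_left ?_
      rintro rfl; exact hp hx

lemma facet_count (lt : α → ℕ) (L : List α) (hL : L.Nodup) (K : ℕ)
    (hK : ∀ p ∈ L, lt p + 1 < K) (w : ℕ → ℕ) (cells : Finset α) (hc : L.toFinset = cells)
    (NC : Finset α → Prop) (hmono : ∀ F G, F ⊆ G → NC G → NC F)
    (hNC : ∀ F ⊆ cells, NC F ↔ proc lt (cells \ F) L w = id) :
    (cells.powerset.filter fun F => NC F ∧ ∀ c ∈ cells, c ∉ F → ¬ NC (insert c F)).card =
    (cells.powerset.filter fun S => ValidW lt S L w).card := by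
  have hcard := fun S hS => ValidW.card lt K L hL S hS hK w
  rw [hc] at hcard
  apply Finset.card_bij (fun F _ => cells \ F)
  · intro F hF
    simp only [Finset.mem_filter, Finset.mem_powerset] at hF ⊢
    obtain ⟨hF, h1, h2⟩ := hF
    refine ⟨Finset.sdiff_subset, ?_⟩
    obtain ⟨S, hS1, hS2, hS3⟩ := exists_valid lt _ L hL w ((hNC F hF).1 h1)
    rw [hc] at hS2
    have : S = cells \ F := by
      apply Finset.Subset.antisymm hS1
      intro c hcF
      by_contra hcS
      rw [Finset.mem_sdiff] at hcF
      apply h2 c hcF.1 hcF.2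
      apply hmono _ (cells \ S)
      · intro x hx
        rw [Finset.mem_insert] at hx
        rw [Finset.mem_sdiff]
        rcases hx with rfl | hx
        · exact ⟨hcF.1, hcS⟩
        · refine ⟨hF hx, fun h => ?_⟩
          exact (Finset.mem_sdiff.1 (hS1 h)).2 hx
      · rw [hNC _ Finset.sdiff_subset, Finset.sdiff_sdiff_eq_self hS2]
        exact hS3.proc
    rw [← this]; exact hS3
  · intro F hF G hG e
    simp only [Finset.mem_filter, Finset.mem_powerset] at hF hG
    rw [← Finset.sdiff_sdiff_eq_self hF.1, ← Finset.sdiff_sdiff_eq_self hG.1, e]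
  · intro S hS
    simp only [Finset.mem_filter, Finset.mem_powerset] at hS
    refine ⟨cells \ S, ?_, Finset.sdiff_sdiff_eq_self hS.1⟩
    simp only [Finset.mem_filter, Finset.mem_powerset]
    refine ⟨Finset.sdiff_subset, ?_, ?_⟩
    · rw [hNC _ Finset.sdiff_subset, Finset.sdiff_sdiff_eq_self hS.1]
      exact hS.2.proc
    · intro c hcc hcS hN
      have hsub : insert c (cells \ S) ⊆ cells := Finset.insert_subset hcc Finset.sdiff_subset
      rw [hNC _ hsub] at hN
      obtain ⟨S', h1, h2, h3⟩ := exists_valid lt _ L hL w hN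
      rw [hc] at h2
      have e1 := hcard S' h2 h3
      have e2 := hcard S hS.1 hS.2
      have hcS' : c ∈ S := by
        by_contra h; exact hcS (Finset.mem_sdiff.2 ⟨hcc, h⟩)
      have hss : S' ⊆ S.erase c := by
        intro x hx
        have := h1 hx
        simp only [Finset.mem_sdiff, Finset.mem_insert, not_or, not_and, not_not] at this
        exact Finset.mem_erase.2 ⟨this.2.1, this.2.2 this.1⟩
      have := Finset.card_le_card hss
      rw [Finset.card_erase_of_mem hcS'] at this
      have : 0 < S.card := Finset.card_pos.2 ⟨c, hcS'⟩
      omega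

end MaxFill

namespace MaxFill
variable {α : Type*}

lemma swp_inj (u : ℕ → ℕ) (l : ℕ) (h : Function.Injective u) : Function.Injective (swp u l) := by
  intro a b hab
  rw [swp_sig, swp_sig] at hab
  have := congrArg (sig l) (h hab)
  rwa [sig_sig, sig_sig] at this

lemma proc_inj (lt : α → ℕ) (C : Finset α) (L : List α) (u : ℕ → ℕ) (h : Function.Injective u) :
    Function.Injective (proc lt C L u) := by
  induction L generalizing u with
  | nil => exact h
  | cons p L ih =>
    simp only [proc]
    apply ih
    unfold stp
    split_ifs
    · exact swp_inj _ _ h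
    · exact h

lemma eq_id_of_rk (u : ℕ → ℕ) (h : Function.Injective u) (hr : ∀ V, V + 1 ≤ rk u V V) : u = id := by
  have hle : ∀ V, u V ≤ V := by
    intro V
    have h1 := hr V
    unfold rk at h1
    have h2 : (Finset.range (V+1)).filter (fun j => u j ≤ V) = Finset.range (V+1) := by
      apply Finset.eq_of_subset_of_card_le (Finset.filter_subset _ _)
      simpa using h1
    have : V ∈ (Finset.range (V+1)).filter (fun j => u j ≤ V) := by rw [h2]; simp
    exact (Finset.mem_filter.1 this).2
  funext j
  simp only [id]
  induction j using Nat.strong_induction_on with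
  | _ j ih =>
    by_contra hne
    have h1 := hle j
    have h2 := ih (u j) (by omega)
    exact hne (h h2)

lemma rk_id (V : ℕ) : rk id V V = V + 1 := by
  unfold rk
  rw [Finset.filter_true_of_mem]
  · simp
  · intro j hj
    simp at hj ⊢; omega

lemma Tab.stable {rr : ℕ → ℕ → ℕ} {Cc : ℕ → ℕ → Prop} {n : ℕ} (h : Tab rr Cc n) (y V : ℕ)
    (hy : y ≤ n) (hC : ∀ z, y < z → z ≤ n → ¬ Cc z V) : rr n V = rr y V := by
  obtain ⟨d, rfl⟩ : ∃ d, n = y + d := ⟨n - y, by omega⟩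
  have : ∀ e ≤ d, rr (y + e) V = rr y V := by
    intro e
    induction e with
    | zero => intro _; rfl
    | succ e ih =>
      intro he
      rw [← add_assoc, h.rec0 (y+e) V (by omega) (hC _ (by omega) (by omega)), ih (by omega)]
  exact this d le_rfl

lemma ChainT.card_row {T : Finset (ℕ × ℕ)} (h : ChainT T) (y : ℕ)
    (hy : ∀ a ∈ T, 1 ≤ a.1 ∧ a.1 ≤ y) : T.card ≤ y := by
  have : T.card ≤ (Finset.Icc 1 y).card := by
    apply Finset.card_le_card_of_injOn Prod.fst
    · intro a ha; simp; exact hy a ha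
    · intro a ha b hb hab
      by_contra hne
      have := h a ha b hb hne
      omega
  simpa using this

lemma ChainT.card_x {T : Finset (ℕ × ℕ)} (h : ChainT T) (x0 q : ℕ)
    (hy : ∀ a ∈ T, x0 < a.2 ∧ a.2 ≤ q) : T.card ≤ q - x0 := by
  have : T.card ≤ (Finset.Ioc x0 q).card := by
    apply Finset.card_le_card_of_injOn Prod.snd
    · intro a ha; simp; exact hy a ha
    · intro a ha b hb hab
      by_contra hne
      have := h a ha b hb hne
      omega
  simpa using this

lemma ChainT.subset {T T' : Finset (ℕ × ℕ)} (h : ChainT T) (hs : T' ⊆ T) : ChainT T' :=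
  fun a ha b hb => h a (hs ha) b (hs hb)

/-! ### start permutations -/

def wSE (n k j : ℕ) : ℕ :=
  if j ≤ k then j else if j ≤ n then j + (n-k) else if j ≤ 2*n-k then 2*n+1-j else j

def wNE (n k j : ℕ) : ℕ :=
  if j ≤ 2*k then j else if j ≤ n+k then 2*j-2*k else if j ≤ 2*n-1 then j+(n-k)
  else if j ≤ 3*n-k-1 then 2*j+2*k+1-4*n else j

lemma wSE_inj (n k : ℕ) (h : k ≤ n) : Function.Injective (wSE n k) := by
  intro a b
  unfold wSE
  split_ifs <;> omega

lemma wNE_inj (n k : ℕ) (h : k ≤ n) : Function.Injective (wNE n k) := by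
  intro a b
  unfold wNE
  split_ifs <;> omega

lemma seg_succ (q a b : ℕ) : min (q+1) b - a =
    (min q b - a) + if a < q+1 ∧ q+1 ≤ b then 1 else 0 := by
  split_ifs <;> omega

lemma rk_wSE (n k V q : ℕ) (h : k ≤ n) : rk (wSE n k) V q =
    1 + (min q (min k V) - 0) + (min q (min n (V+k-n)) - k) + (min q (2*n-k) - max n (2*n-V))
      + (min q V - (2*n-k)) := by
  induction q with
  | zero =>
    rw [rk_zero]
    have : wSE n k 0 = 0 := by simp [wSE]
    simp only [this]
    simp
  | succ q ih =>
    rw [rk_succ, ih]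
    rw [seg_succ, seg_succ q k, seg_succ q (max _ _), seg_succ q (2*n-k)]
    have : wSE n k (q+1) = if q+1 ≤ k then q+1 else if q+1 ≤ n then q+1 + (n-k)
      else if q+1 ≤ 2*n-k then 2*n+1-(q+1) else q+1 := rfl
    generalize wSE n k (q+1) = z at *
    have key : (if z ≤ V then 1 else 0) = (if 0 < q+1 ∧ q+1 ≤ min k V then 1 else 0)
      + (if k < q+1 ∧ q+1 ≤ min n (V+k-n) then 1 else 0)
      + (if max n (2*n-V) < q+1 ∧ q+1 ≤ 2*n-k then 1 else 0)
      + (if 2*n-k < q+1 ∧ q+1 ≤ V then 1 else 0) := by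
      simp only [le_min_iff, max_lt_iff]
      clear ih
      split_ifs at this <;> split_ifs <;> omega
    omega

lemma rk_wNE (n k V q : ℕ) (h : k ≤ n) (hn : 1 ≤ n) : rk (wNE n k) V q =
    1 + (min q (min (2*k) V) - 0) + (min q (min (n+k) (k+V/2)) - 2*k)
      + (min q (min (2*n-1) (V-(n-k))) - (n+k))
      + (min q (min (3*n-k-1) ((V+4*n-2*k-1)/2)) - (2*n-1)) + (min q V - max (2*k) (3*n-k-1)) := by
  induction q with
  | zero =>
    rw [rk_zero]
    have : wNE n k 0 = 0 := by simp [wNE]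
    simp only [this]
    simp
  | succ q ih =>
    rw [rk_succ, ih]
    rw [seg_succ, seg_succ q (2*k), seg_succ q (n+k), seg_succ q (2*n-1), seg_succ q (max _ _)]
    have : wNE n k (q+1) = if q+1 ≤ 2*k then q+1 else if q+1 ≤ n+k then 2*(q+1)-2*k
      else if q+1 ≤ 2*n-1 then q+1+(n-k)
      else if q+1 ≤ 3*n-k-1 then 2*(q+1)+2*k+1-4*n else q+1 := rfl
    generalize wNE n k (q+1) = z at *
    have key : (if z ≤ V then 1 else 0) = (if 0 < q+1 ∧ q+1 ≤ min (2*k) V then 1 else 0)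
      + (if 2*k < q+1 ∧ q+1 ≤ min (n+k) (k+V/2) then 1 else 0)
      + (if n+k < q+1 ∧ q+1 ≤ min (2*n-1) (V-(n-k)) then 1 else 0)
      + (if 2*n-1 < q+1 ∧ q+1 ≤ min (3*n-k-1) ((V+4*n-2*k-1)/2) then 1 else 0)
      + (if max (2*k) (3*n-k-1) < q+1 ∧ q+1 ≤ V then 1 else 0) := by
      simp only [le_min_iff, max_lt_iff]
      clear ih
      split_ifs at this <;> split_ifs <;> omega
    omega

end MaxFill

namespace MaxFill

lemma mem_rowsL {α : Type*} (cell : ℕ → ℕ → α) (len : ℕ → ℕ) (n : ℕ) (p : α) :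
    p ∈ rowsL cell len n ↔ ∃ y, 1 ≤ y ∧ y ≤ n ∧ ∃ s < len y, cell y s = p := by
  simp only [rowsL, List.mem_flatMap, List.mem_range, List.mem_map]
  constructor
  · rintro ⟨i, hi, s, hs, rfl⟩
    exact ⟨i+1, by omega, by omega, s, hs, rfl⟩
  · rintro ⟨y, h1, h2, s, hs, rfl⟩
    refine ⟨y-1, by omega, s, ?_, ?_⟩
    · rwa [show y - 1 + 1 = y by omega]
    · rw [show y - 1 + 1 = y by omega]

lemma nodup_rowsL (cell : ℕ → ℕ → ℕ × ℕ) (len : ℕ → ℕ) (n : ℕ)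
    (h1 : ∀ y s, (cell y s).1 = y)
    (h2 : ∀ y s t, s < len y → t < len y → cell y s = cell y t → s = t) :
    (rowsL cell len n).Nodup := by
  induction n with
  | zero => simp [rowsL]
  | succ n ih =>
    rw [rowsL_succ]
    apply List.Nodup.append ih
    · apply List.Nodup.map_on _ List.nodup_range
      intro s hs t ht hst
      exact h2 _ _ _ (List.mem_range.1 hs) (List.mem_range.1 ht) hst
    · intro p hp hp2
      rw [mem_rowsL] at hp
      obtain ⟨y, hy1, hy2, s, hs, rfl⟩ := hp
      rw [List.mem_map] at hp2
      obtain ⟨t, _, ht⟩ := hp2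
      have := congrArg Prod.fst ht
      rw [h1, h1] at this
      omega

def SEch (T : Finset (ℕ × ℕ)) : Prop :=
  (∀ a ∈ T, ∀ b ∈ T, a ≠ b → (a.1 < b.1 ∧ a.2 < b.2) ∨ (b.1 < a.1 ∧ b.2 < a.2)) ∧
    ∀ a ∈ T, ∀ b ∈ T, a.1 ≤ b.2

def NCne (k : ℕ) (F : Finset (ℕ × ℕ)) : Prop := ∀ T ⊆ F, ChainT T → T.card ≤ k
def NCse (k : ℕ) (F : Finset (ℕ × ℕ)) : Prop := ∀ T ⊆ F, SEch T → T.card ≤ k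

lemma mem_cellsP (n : ℕ) (p : ℕ × ℕ) : p ∈ cellsP n ↔
    1 ≤ p.1 ∧ p.1 ≤ n ∧ p.1 ≤ p.2 ∧ p.2 ≤ 2*n-1 := by
  simp only [cellsP, Finset.mem_filter, Finset.mem_product, Finset.mem_Icc]
  omega

def ltNE (p : ℕ × ℕ) : ℕ := p.1 + p.2 - 1
def cellNE (n y s : ℕ) : ℕ × ℕ := (y, 2*n-1-s)
def listNE (n : ℕ) : List (ℕ × ℕ) := rowsL (cellNE n) (fun y => 2*n-y) n

def ltSE (n : ℕ) (p : ℕ × ℕ) : ℕ := p.1 + 2*n - p.2 - 1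
def cellSE (y s : ℕ) : ℕ × ℕ := (y, y+s)
def listSE (n : ℕ) : List (ℕ × ℕ) := rowsL cellSE (fun y => 2*n-y) n

lemma listNE_nodup (n : ℕ) : (listNE n).Nodup := by
  apply nodup_rowsL
  · intros; rfl
  · intro y s t hs ht h
    simp only [cellNE, Prod.mk.injEq, true_and] at h
    by_cases hy : y = 0
    · omega
    omega

lemma listSE_nodup (n : ℕ) : (listSE n).Nodup := by
  apply nodup_rowsL
  · intros; rfl
  · intro y s t hs ht h
    simp only [cellSE, Prod.mk.injEq, true_and] at h
    omega

lemma listNE_mem (n : ℕ) (p : ℕ × ℕ) : p ∈ listNE n ↔ p ∈ cellsP n := by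
  rw [listNE, mem_rowsL, mem_cellsP]
  constructor
  · rintro ⟨y, h1, h2, s, hs, rfl⟩
    simp only [cellNE]; omega
  · rintro ⟨h1, h2, h3, h4⟩
    refine ⟨p.1, h1, h2, 2*n-1-p.2, by omega, ?_⟩
    ext <;> simp [cellNE]; omega

lemma listSE_mem (n : ℕ) (p : ℕ × ℕ) : p ∈ listSE n ↔ p ∈ cellsP n := by
  rw [listSE, mem_rowsL, mem_cellsP]
  constructor
  · rintro ⟨y, h1, h2, s, hs, rfl⟩
    simp only [cellSE]; omega
  · rintro ⟨h1, h2, h3, h4⟩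
    refine ⟨p.1, h1, h2, p.2-p.1, by omega, ?_⟩
    ext <;> simp [cellSE]; omega

lemma seTab (n : ℕ) (C : Finset (ℕ × ℕ)) (w : ℕ → ℕ) (V : ℕ) :
    Tab (fun y P => rk (proc (ltSE n) C (rowsL cellSE (fun y => 2*n-y) y) w) V P)
      (fun y P => P ≤ 2*n-1 ∧ 2*n-1-P < 2*n-y ∧ cellSE y (2*n-1-P) ∈ C) n := by
  apply tab_proc (ltSE n) C cellSE (fun y => 2*n-y) (fun _ => 2*n-1) n
  · intro y h1 h2; omega
  · intro y h1 h2 s hs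
    simp only [ltSE, cellSE]; omega

lemma neTab (n : ℕ) (C : Finset (ℕ × ℕ)) (w : ℕ → ℕ) (V : ℕ) :
    Tab (fun y P => rk (proc ltNE C (rowsL (cellNE n) (fun y => 2*n-y) y) w) V P)
      (fun y P => P ≤ 2*n+y-2 ∧ 2*n+y-2-P < 2*n-y ∧ cellNE n y (2*n+y-2-P) ∈ C) n := by
  apply tab_proc ltNE C (cellNE n) (fun y => 2*n-y) (fun y => 2*n+y-2) n
  · intro y h1 h2; omega
  · intro y h1 h2 s hs
    simp only [ltNE, cellNE]; omega

set_option maxHeartbeats 1000000 in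
lemma ar_se2 (n k V q l R : ℕ) (hk : k ≤ n) (hV : n ≤ V) (hq : V - n ≤ q) (b1 : l ≤ n)
  (b2 : l ≤ q - (V-n)) (b3 : l ≤ k + (q - (2*n-n)))
  (hr : 1 + (min q (min k V) - 0) + (min q (min n (V+k-n)) - k) + (min q (2*n-k) - max n (2*n-V))
      + (min q V - (2*n-k)) + n ≤ R + l) : V + 1 ≤ R := by
  rw [show min k V = k by omega, show max n (2*n-V) = n by omega] at hr
  have b3' : l ≤ k + (q - n) := by omega
  clear b3
  rcases le_total q k with h1 | h1
  · rw [min_eq_left h1] at hr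
    omega
  rw [min_eq_right h1] at hr
  rcases le_total q n with h2 | h2
  · rw [show q - n = 0 by omega] at b3'
    rcases le_total V (2*n-k) with h3 | h3
    · omega
    · omega
  rw [show min q (min n (V+k-n)) = min n (V+k-n) by omega] at hr
  rcases le_total V (2*n-k) with h3 | h3
  · omega
  rcases le_total V (2*n) with h4 | h4
  · omega
  · rw [show min n (V+k-n) = n by omega] at hr
    omega

set_option maxHeartbeats 1000000 in
lemma ar_ne1 (n k p l : ℕ) (hn : 1 ≤ n) (hk : k < l) (hl : l ≤ p) (hp : p ≤ n) 
  (hr : 2*p-1+1+l ≤ 1 + (min (2*n-1) (min (2*k) (2*p-1)) - 0) + (min (2*n-1) (min (n+k) (k+(2*p-1)/2)) - 2*k)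
      + (min (2*n-1) (min (2*n-1) ((2*p-1)-(n-k))) - (n+k))
      + (min (2*n-1) (min (3*n-k-1) (((2*p-1)+4*n-2*k-1)/2)) - (2*n-1)) + (min (2*n-1) (2*p-1) - max (2*k) (3*n-k-1)) + p) : False := by
  rw [show min (2*n-1) (min (2*k) (2*p-1)) = 2*k by omega,
   show min (2*n-1) (min (n+k) (k+(2*p-1)/2)) = k+p-1 by omega,
   show (min (2*n-1) (min (2*n-1) ((2*p-1)-(n-k))) - (n+k)) = 0 by omega,
   show (min (2*n-1) (min (3*n-k-1) (((2*p-1)+4*n-2*k-1)/2)) - (2*n-1)) = 0 by omega,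
   show (min (2*n-1) (2*p-1) - max (2*k) (3*n-k-1)) = 0 by omega] at hr
  omega

set_option maxHeartbeats 2000000 in
lemma ar_ne2 (n k V q l R y : ℕ) (hn : 1 ≤ n) (hk : k ≤ n) (hy : y = min ((V+1)/2) n) (hq : V - y ≤ q) (b1 : l ≤ y)
  (b2 : l ≤ q - (V-y)) (b3 : l ≤ k + (q - (2*n-1)))
  (hr : 1 + (min q (min (2*k) V) - 0) + (min q (min (n+k) (k+V/2)) - 2*k)
      + (min q (min (2*n-1) (V-(n-k))) - (n+k))
      + (min q (min (3*n-k-1) ((V+4*n-2*k-1)/2)) - (2*n-1)) + (min q V - max (2*k) (3*n-k-1)) + y ≤ R + l) : V + 1 ≤ R := by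
  obtain ⟨a1, h1⟩ : ∃ a, a = min q (min (2*k) V) - 0 := ⟨_, rfl⟩
  obtain ⟨a2, h2⟩ : ∃ a, a = min q (min (n+k) (k+V/2)) - 2*k := ⟨_, rfl⟩
  obtain ⟨a3, h3⟩ : ∃ a, a = min q (min (2*n-1) (V-(n-k))) - (n+k) := ⟨_, rfl⟩
  obtain ⟨a4, h4⟩ : ∃ a, a = min q (min (3*n-k-1) ((V+4*n-2*k-1)/2)) - (2*n-1) := ⟨_, rfl⟩
  obtain ⟨a5, h5⟩ : ∃ a, a = min q V - max (2*k) (3*n-k-1) := ⟨_, rfl⟩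
  rw [← h1, ← h2, ← h3, ← h4, ← h5] at hr
  rcases le_total V (2*k) with c1 | c1
  · clear h2 h3 h4 h5
    have : y = (V+1)/2 := by omega
    omega
  rcases le_total V (2*n) with c2 | c2
  · clear h3 h5
    have hy : y = (V+1)/2 := by omega
    have e : a1 + a2 = min q (k+V/2) := by clear h4 hr b1 b2 b3; omega
    clear h1 h2
    rcases le_total q (k+V/2) with d1 | d1
    · clear h4; omega
    rcases le_total q (2*n-1) with d2 | d2
    · clear h4; omega
    have e4 : a4 = min (q-(2*n-1)) (y-k) := by 
      clear e hr b1 b2 b3 d1 hq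
      rcases Nat.even_or_odd' V with ⟨v, rfl | rfl⟩
      · have hyv : y = v := by clear h4; omega
        by_cases hv : v = 0
        · subst hv; omega
        have e : (2*v+4*n-2*k-1)/2 = 2*n-k+v-1 := by omega
        rw [e] at h4
        clear e hy
        rw [hyv]
        clear hyv
        omega
      · have hyv : y = v+1 := by clear h4; omega
        have e : (2*v+1+4*n-2*k-1)/2 = 2*n-k+v := by omega
        rw [e] at h4
        clear e hy
        rw [hyv]
        clear hyv
        omega
    clear h4
    omega
  · have hy' : y = n := by clear h1 h2 h3 h4 h5 hr b1 b2 b3; omega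
    subst hy'
    rw [show min (2*k) V = 2*k by clear h1 h2 h3 h4 h5 hr b1 b2 b3; omega] at h1
    rw [show min (y+k) (k+V/2) = y+k by clear h1 h2 h3 h4 h5 hr b1 b2 b3; omega] at h2
    rw [show min (3*y-k-1) ((V+4*y-2*k-1)/2) = 3*y-k-1 by clear h1 h2 h3 h4 h5 hr b1 b2 b3; omega] at h4
    have e : a1 + a2 = min q (y+k) := by clear h3 h4 h5 hr b1 b2 b3; omega
    clear h1 h2 hy
    by_cases hky : k = y
    · subst hky
      clear h3 h4
      omega
    rw [show max (2*k) (3*y-k-1) = 3*y-k-1 by clear h3 h4 h5 hr b1 b2 b3; omega] at h5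
    have e3 : a1 + a2 + a3 = min q (min (2*y-1) (V-(y-k))) := by
      clear h4 h5 hr b1 b2 b3; omega
    clear h3 e
    have e4 : a4 + a5 = min q (max V (3*y-k-1)) - (2*y-1) := by
      clear hr b1 b2 b3 e3; omega
    clear h4 h5
    obtain ⟨s, hs⟩ : ∃ s, s = a1 + a2 + a3 := ⟨_, rfl⟩
    obtain ⟨t, ht⟩ : ∃ t, t = a4 + a5 := ⟨_, rfl⟩
    have hr : 1 + s + t + y ≤ R + l := by omega
    rw [← hs] at e3
    rw [← ht] at e4
    clear hs ht
    rcases le_total q (2*y-1) with d1 | d1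
    · clear e4
      omega
    · rcases le_total V (3*y-k-1) with d2 | d2
      · rw [max_eq_right d2] at e4
        omega
      · rw [max_eq_left d2] at e4
        rw [show min q (min (2*y-1) (V-(y-k))) = 2*y-1 by clear hr b1 b2 b3 e4; omega] at e3
        omega

lemma se_D1 (n k : ℕ) (hk : k ≤ n) (F : Finset (ℕ × ℕ)) (hF : F ⊆ cellsP n)
    (h : proc (ltSE n) (cellsP n \ F) (listSE n) (wSE n k) = id) : NCse k F := by
  intro T hTF hT
  by_contra hcard
  push Not at hcard
  have hne : T.Nonempty := Finset.card_pos.1 (by omega)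
  obtain ⟨a, ha, hamax⟩ := Finset.exists_max_image T Prod.fst hne
  obtain ⟨b, hb, hbmin⟩ := Finset.exists_min_image T Prod.snd hne
  have hcell : ∀ c ∈ T, _ := fun c hc => (mem_cellsP n c).1 (hF (hTF hc))
  have ha' := hcell a ha
  have hb' := hcell b hb
  have hab := hT.2 a ha b hb
  have tab := seTab n (cellsP n \ F) (wSE n k) a.1
  have h1 := tab.upper (2*n-b.2) a.1 ha'.2.1 0 (by omega) (T.image (fun c => (c.1, 2*n-c.2)))
    (by
      intro c hc d hd hcd
      rw [Finset.mem_image] at hc hd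
      obtain ⟨c, hc, rfl⟩ := hc
      obtain ⟨d, hd, rfl⟩ := hd
      have hne : c ≠ d := by rintro rfl; exact hcd rfl
      have h1 := hT.1 c hc d hd hne
      have h2 := hcell c hc
      have h3 := hcell d hd
      simp only
      omega)
    (by
      intro c hc
      rw [Finset.mem_image] at hc
      obtain ⟨c, hc, rfl⟩ := hc
      have h2 := hcell c hc
      have h3 := hamax c hc
      have h4 := hbmin c hc
      refine ⟨h2.1, h3, by simp only; omega, by simp only; omega, ?_⟩
      rintro ⟨_, _, h7⟩
      rw [Finset.mem_sdiff] at h7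
      apply h7.2
      have : cellSE c.1 (2*n-1-(c.1 + (2*n-c.2) - 1)) = c := by
        ext <;> simp [cellSE]; omega
      simp only [this]
      exact hTF hc)
  rw [Finset.card_image_of_injOn (by
      intro c hc d hd hcd
      have h2 := hcell c hc
      have h3 := hcell d hd
      simp only [Prod.mk.injEq] at hcd
      ext
      · exact hcd.1
      · omega)] at h1
  have h2 := tab.stable a.1 a.1 ha'.2.1 (by
    rintro z hz hzn ⟨h1, h2, _⟩
    omega)
  simp only [add_zero] at h1
  rw [← h2] at h1
  change rk (proc (ltSE n) (cellsP n \ F) (listSE n) (wSE n k)) a.1 a.1 + _ ≤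
    rk (wSE n k) _ _ + _ at h1
  rw [h, rk_id, rk_wSE _ _ _ _ hk] at h1
  omega

lemma se_D2 (n k : ℕ) (hk : k ≤ n) (F : Finset (ℕ × ℕ))
    (h : NCse k F) : proc (ltSE n) (cellsP n \ F) (listSE n) (wSE n k) = id := by
  apply eq_id_of_rk _ (proc_inj _ _ _ _ (wSE_inj n k hk))
  intro V
  have tab := seTab n (cellsP n \ F) (wSE n k) V
  obtain ⟨q, T, hT, hq, hT2, hr⟩ := tab.lower (fun _ => 2*n-1) (by
    rintro y P hP ⟨h1, _⟩; omega) (min V n) (min_le_right _ _) (V - min V n)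
  have h2 := tab.stable (min V n) V (min_le_right _ _) (by
    rintro z hz hzn ⟨h1, h2, _⟩
    omega)
  rw [show min V n + (V - min V n) = V by omega, ← h2] at hr
  change rk (wSE n k) _ _ + _ ≤
    rk (proc (ltSE n) (cellsP n \ F) (listSE n) (wSE n k)) V V + _ at hr
  have b1 : T.card ≤ min V n := hT.card_row _ (fun a ha => ⟨(hT2 a ha).1, (hT2 a ha).2.1⟩)
  have b2 : T.card ≤ q - (V - min V n) :=
    hT.card_x _ _ (fun a ha => ⟨(hT2 a ha).2.2.1, (hT2 a ha).2.2.2.1⟩)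
  have b3 : (T.filter (fun a => ¬ a.2 ≤ 2*n - min V n)).card ≤ q - (2*n - min V n) := by
    apply (hT.subset (Finset.filter_subset _ _)).card_x
    intro a ha
    rw [Finset.mem_filter] at ha
    exact ⟨by omega, (hT2 a ha.1).2.2.2.1⟩
  have b4 : (T.filter (fun a => a.2 ≤ 2*n - min V n)).card ≤ k := by
    have := h ((T.filter (fun a => a.2 ≤ 2*n - min V n)).image (fun c => (c.1, 2*n-c.2))) ?_ ?_
    · rwa [Finset.card_image_of_injOn] at this
      intro c hc d hd hcd
      simp only [Finset.coe_filter, Set.mem_ofPred_eq] at hc hd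
      simp only [Prod.mk.injEq] at hcd
      ext
      · exact hcd.1
      · omega
    · intro c hc
      rw [Finset.mem_image] at hc
      obtain ⟨c, hc, rfl⟩ := hc
      rw [Finset.mem_filter] at hc
      have h3 := hT2 c hc.1
      by_contra hcF
      apply h3.2.2.2.2
      have : cellSE c.1 (2*n-1-(c.1 + c.2 - 1)) = (c.1, 2*n-c.2) := by
        ext <;> simp [cellSE]; omega
      rw [this]
      refine ⟨by omega, by omega, ?_⟩
      rw [Finset.mem_sdiff, mem_cellsP]
      simp only
      exact ⟨by omega, hcF⟩
    · constructor
      · intro c hc d hd hcd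
        rw [Finset.mem_image] at hc hd
        obtain ⟨c, hc, rfl⟩ := hc
        obtain ⟨d, hd, rfl⟩ := hd
        rw [Finset.mem_filter] at hc hd
        have hne : c ≠ d := by rintro rfl; exact hcd rfl
        have h1 := hT c hc.1 d hd.1 hne
        simp only
        omega
      · intro c hc d hd
        rw [Finset.mem_image] at hc hd
        obtain ⟨c, hc, rfl⟩ := hc
        obtain ⟨d, hd, rfl⟩ := hd
        rw [Finset.mem_filter] at hc hd
        have h1 := hT2 c hc.1
        simp only
        omega
  have b5 := Finset.card_filter_add_card_filter_not (s := T) (fun a => a.2 ≤ 2*n - min V n)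
  rw [rk_wSE _ _ _ _ hk] at hr
  generalize rk (proc (ltSE n) (cellsP n \ F) (listSE n) (wSE n k)) V V = R at *
  rcases le_total V n with hV | hV
  · rw [min_eq_left hV] at *
    omega
  · rw [min_eq_right hV] at *
    exact ar_se2 n k V q T.card R hk hV hq b1 b2 (by omega) hr

lemma ne_D1 (n k : ℕ) (hn : 1 ≤ n) (hk : k ≤ n) (F : Finset (ℕ × ℕ)) (hF : F ⊆ cellsP n)
    (h : proc ltNE (cellsP n \ F) (listNE n) (wNE n k) = id) : NCne k F := by
  intro T hTF hT
  by_contra hcard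
  push Not at hcard
  have hne : T.Nonempty := Finset.card_pos.1 (by omega)
  obtain ⟨a, ha, hamax⟩ := Finset.exists_max_image T Prod.fst hne
  have hcell : ∀ c ∈ T, _ := fun c hc => (mem_cellsP n c).1 (hF (hTF hc))
  have ha' := hcell a ha
  have b1 := hT.card_row a.1 (fun c hc => ⟨(hcell c hc).1, hamax c hc⟩)
  have tab := neTab n (cellsP n \ F) (wNE n k) (2*a.1-1)
  have h1 := tab.upper (2*n-1) a.1 ha'.2.1 (a.1-1) (by omega) T hT
    (by
      intro c hc
      have h2 := hcell c hc
      have h3 := hamax c hc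
      have h4 : a.2 ≤ c.2 := by
        by_cases hac : a = c
        · rw [hac]
        · have := hT a ha c hc hac
          omega
      refine ⟨h2.1, h3, by omega, by omega, ?_⟩
      rintro ⟨_, _, h7⟩
      rw [Finset.mem_sdiff] at h7
      apply h7.2
      have : cellNE n c.1 (2*n+c.1-2-(c.1+c.2-1)) = c := by
        ext <;> simp [cellNE]; omega
      rw [this]
      exact hTF hc)
  have h2 := tab.stable a.1 (2*a.1-1) ha'.2.1 (by
    rintro z hz hzn ⟨h1, h2, _⟩
    omega)
  rw [show a.1 + (a.1 - 1) = 2*a.1-1 by omega] at h1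
  rw [← h2] at h1
  change rk (proc ltNE (cellsP n \ F) (listNE n) (wNE n k)) (2*a.1-1) (2*a.1-1) + _ ≤
    rk (wNE n k) _ _ + _ at h1
  rw [h, rk_id, rk_wNE _ _ _ _ hk hn] at h1
  exact ar_ne1 n k a.1 T.card hn hcard b1 ha'.2.1 h1

lemma ne_D2 (n k : ℕ) (hn : 1 ≤ n) (hk : k ≤ n) (F : Finset (ℕ × ℕ))
    (h : NCne k F) : proc ltNE (cellsP n \ F) (listNE n) (wNE n k) = id := by
  apply eq_id_of_rk _ (proc_inj _ _ _ _ (wNE_inj n k hk))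
  intro V
  have tab := neTab n (cellsP n \ F) (wNE n k) V
  obtain ⟨y, hy⟩ : ∃ y, y = min ((V+1)/2) n := ⟨_, rfl⟩
  have hyn : y ≤ n := by omega
  obtain ⟨q, T, hT, hq, hT2, hr⟩ := tab.lower (fun y => 2*n+y-2) (by
    rintro y P hP ⟨h1, _⟩; omega) y hyn (V - y)
  have h2 := tab.stable y V hyn (by
    rintro z hz hzn ⟨h1, h2, _⟩
    omega)
  rw [show y + (V - y) = V by omega, ← h2] at hr
  change rk (wNE n k) _ _ + _ ≤
    rk (proc ltNE (cellsP n \ F) (listNE n) (wNE n k)) V V + _ at hr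
  have b1 : T.card ≤ y := hT.card_row _ (fun a ha => ⟨(hT2 a ha).1, (hT2 a ha).2.1⟩)
  have b2 : T.card ≤ q - (V - y) :=
    hT.card_x _ _ (fun a ha => ⟨(hT2 a ha).2.2.1, (hT2 a ha).2.2.2.1⟩)
  have b3 : (T.filter (fun a => ¬ a.2 ≤ 2*n-1)).card ≤ q - (2*n-1) := by
    apply (hT.subset (Finset.filter_subset _ _)).card_x
    intro a ha
    rw [Finset.mem_filter] at ha
    exact ⟨by omega, (hT2 a ha.1).2.2.2.1⟩
  have b4 : (T.filter (fun a => a.2 ≤ 2*n-1)).card ≤ k := by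
    apply h _ _ (hT.subset (Finset.filter_subset _ _))
    intro c hc
    rw [Finset.mem_filter] at hc
    have h3 := hT2 c hc.1
    by_contra hcF
    apply h3.2.2.2.2
    have : cellNE n c.1 (2*n+c.1-2-(c.1+c.2-1)) = c := by
      ext <;> simp [cellNE]; omega
    rw [this]
    refine ⟨by omega, by omega, ?_⟩
    rw [Finset.mem_sdiff, mem_cellsP]
    exact ⟨by omega, hcF⟩
  have b5 := Finset.card_filter_add_card_filter_not (s := T) (fun a => a.2 ≤ 2*n-1)
  rw [rk_wNE _ _ _ _ hk hn] at hr
  generalize rk (proc ltNE (cellsP n \ F) (listNE n) (wNE n k)) V V = R at *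
  exact ar_ne2 n k V q T.card R y hn hk hy hq b1 b2 (by omega) hr

end MaxFill

namespace MaxFill

lemma neLen_le (k : ℕ) (S : Finset (ℕ × ℕ)) : neLen S ≤ k ↔ NCne k S := by
  unfold neLen NCne ChainT
  rw [Finset.sup_le_iff]
  simp only [Finset.mem_filter, Finset.mem_powerset, and_imp]

lemma seLen_le (k : ℕ) (S : Finset (ℕ × ℕ)) : seLen S ≤ k ↔ NCse k S := by
  unfold seLen NCse SEch
  rw [Finset.sup_le_iff]
  simp only [Finset.mem_filter, Finset.mem_powerset, and_imp]

lemma neLen_mono (S T : Finset (ℕ × ℕ)) (h : S ⊆ T) : neLen S ≤ neLen T := by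
  rw [neLen_le]
  have := (neLen_le (neLen T) T).1 le_rfl
  exact fun U hU => this U (hU.trans h)

lemma seLen_mono (S T : Finset (ℕ × ℕ)) (h : S ⊆ T) : seLen S ≤ seLen T := by
  rw [seLen_le]
  have := (seLen_le (seLen T) T).1 le_rfl
  exact fun U hU => this U (hU.trans h)

lemma erase_sub_of {c : ℕ × ℕ} {U S : Finset (ℕ × ℕ)} (h : U ⊆ insert c S) : U.erase c ⊆ S := by
  intro x hx
  have := h (Finset.mem_of_mem_erase hx)
  rw [Finset.mem_insert] at this
  exact this.resolve_left (Finset.ne_of_mem_erase hx)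

lemma neLen_insert (c : ℕ × ℕ) (S : Finset (ℕ × ℕ)) : neLen (insert c S) ≤ neLen S + 1 := by
  rw [neLen_le]
  have := (neLen_le (neLen S) S).1 le_rfl
  intro U hU hc
  have h1 := this (U.erase c) (erase_sub_of hU) (hc.subset (Finset.erase_subset _ _))
  have := Finset.pred_card_le_card_erase (s := U) (a := c)
  omega

lemma seLen_insert (c : ℕ × ℕ) (S : Finset (ℕ × ℕ)) : seLen (insert c S) ≤ seLen S + 1 := by
  rw [seLen_le]
  have := (seLen_le (seLen S) S).1 le_rfl
  intro U hU hc
  have h1 := this (U.erase c) (erase_sub_of hU)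
    ⟨fun a ha b hb => hc.1 a (Finset.mem_of_mem_erase ha) b (Finset.mem_of_mem_erase hb),
     fun a ha b hb => hc.2 a (Finset.mem_of_mem_erase ha) b (Finset.mem_of_mem_erase hb)⟩
  have := Finset.pred_card_le_card_erase (s := U) (a := c)
  omega

lemma neLen_le_n (n : ℕ) (S : Finset (ℕ × ℕ)) (h : S ⊆ cellsP n) : neLen S ≤ n := by
  rw [neLen_le]
  intro U hU hc
  apply hc.card_row
  intro a ha
  have := (mem_cellsP n a).1 (h (hU ha))
  omega

lemma seLen_le_n (n : ℕ) (S : Finset (ℕ × ℕ)) (h : S ⊆ cellsP n) : seLen S ≤ n := by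
  rw [seLen_le]
  intro U hU hc
  have : U.card ≤ (Finset.Icc 1 n).card := by
    apply Finset.card_le_card_of_injOn Prod.fst
    · intro a ha
      have := (mem_cellsP n a).1 (h (hU ha))
      simp; omega
    · intro a ha b hb hab
      by_contra hne
      have := hc.1 a ha b hb hne
      omega
  simpa using this

lemma neLen_cells (n : ℕ) : n ≤ neLen (cellsP n) := by
  have := (neLen_le _ _).1 (le_refl (neLen (cellsP n)))
    ((Finset.Icc 1 n).image (fun c => (c, 2*n-c))) ?_ ?_
  · rwa [Finset.card_image_of_injective _ (by
      intro a b hab; exact congrArg Prod.fst hab), Nat.card_Icc] at this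
  · intro x hx
    simp only [Finset.mem_image, Finset.mem_Icc] at hx
    obtain ⟨c, hc, rfl⟩ := hx
    rw [mem_cellsP]; simp only; omega
  · intro x hx y hy hxy
    simp only [Finset.mem_image, Finset.mem_Icc] at hx hy
    obtain ⟨c, hc, rfl⟩ := hx
    obtain ⟨d, hd, rfl⟩ := hy
    have : c ≠ d := by rintro rfl; exact hxy rfl
    simp only; omega

lemma seLen_cells (n : ℕ) : n ≤ seLen (cellsP n) := by
  have := (seLen_le _ _).1 (le_refl (seLen (cellsP n)))
    ((Finset.Icc 1 n).image (fun c => (c, n-1+c))) ?_ ?_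
  · rwa [Finset.card_image_of_injective _ (by
      intro a b hab; exact congrArg Prod.fst hab), Nat.card_Icc] at this
  · intro x hx
    simp only [Finset.mem_image, Finset.mem_Icc] at hx
    obtain ⟨c, hc, rfl⟩ := hx
    rw [mem_cellsP]; simp only; omega
  · constructor
    · intro x hx y hy hxy
      simp only [Finset.mem_image, Finset.mem_Icc] at hx hy
      obtain ⟨c, hc, rfl⟩ := hx
      obtain ⟨d, hd, rfl⟩ := hy
      have : c ≠ d := by rintro rfl; exact hxy rfl
      simp only; omega
    · intro x hx y hy
      simp only [Finset.mem_image, Finset.mem_Icc] at hx hy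
      obtain ⟨c, hc, rfl⟩ := hx
      obtain ⟨d, hd, rfl⟩ := hy
      simp only; omega

lemma reduce (len : Finset (ℕ × ℕ) → ℕ) (cells : Finset (ℕ × ℕ)) (k : ℕ)
    (hins : ∀ c S, len (insert c S) ≤ len S + 1) (hk : k ≤ len cells)
    (F : Finset (ℕ × ℕ)) (hF : F ⊆ cells) :
    (len F = k ∧ ∀ c ∈ cells, c ∉ F → len F < len (insert c F)) ↔
    (len F ≤ k ∧ ∀ c ∈ cells, c ∉ F → ¬ len (insert c F) ≤ k) := by
  constructor
  · rintro ⟨h1, h2⟩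
    exact ⟨h1.le, fun c hc hcF => by have := h2 c hc hcF; omega⟩
  · rintro ⟨h1, h2⟩
    have : len F = k := by
      by_contra hne
      have hFc : F = cells := by
        apply Finset.Subset.antisymm hF
        intro c hc
        by_contra hcF
        have h3 := h2 c hc hcF
        have h4 := hins c F
        omega
      rw [hFc] at h1 hne
      omega
    exact ⟨this, fun c hc hcF => by have := h2 c hc hcF; omega⟩

lemma ne_count (n k : ℕ) (hn : 1 ≤ n) (hk : k ≤ n) :
    ((cellsP n).powerset.filter fun F => neLen F = k ∧
        ∀ c ∈ cellsP n, c ∉ F → neLen F < neLen (insert c F)).card =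
    ((listNE n).toFinset.powerset.filter fun S => ValidW ltNE S (listNE n) (wNE n k)).card := by
  have hl : (listNE n).toFinset = cellsP n := by
    ext p; rw [List.mem_toFinset, listNE_mem]
  have hfc := facet_count ltNE (listNE n) (listNE_nodup n) (3*n+1) (by
    intro p hp
    rw [listNE_mem, mem_cellsP] at hp
    unfold ltNE; omega) (wNE n k) (cellsP n) (by rw [← hl]; congr!) (NCne k)
    (fun F G h hG T hT => hG T (hT.trans h))
    (by
      intro F hF
      constructor
      · intro h
        have := ne_D2 n k hn hk F h
        convert this
      · intro h
        apply ne_D1 n k hn hk F hF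
        convert h)
  rw [hl, ← hfc]
  congr 1
  ext F
  simp only [Finset.mem_filter, Finset.mem_powerset]
  apply and_congr_right
  intro hF
  rw [reduce neLen (cellsP n) k neLen_insert (hk.trans (neLen_cells n)) F hF]
  simp only [neLen_le]
  apply and_congr_right
  intro _
  apply forall_congr'; intro c
  apply forall_congr'; intro _
  apply forall_congr'; intro _
  have : insert c F = @insert _ _ (@Finset.instInsert _ (fun a b => Classical.propDecidable (a = b))) c F := by
    congr!
  rw [this]

lemma se_count (n k : ℕ) (hk : k ≤ n) :
    ((cellsP n).powerset.filter fun F => seLen F = k ∧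
        ∀ c ∈ cellsP n, c ∉ F → seLen F < seLen (insert c F)).card =
    ((listSE n).toFinset.powerset.filter fun S => ValidW (ltSE n) S (listSE n) (wSE n k)).card := by
  have hl : (listSE n).toFinset = cellsP n := by
    ext p; rw [List.mem_toFinset, listSE_mem]
  have hfc := facet_count (ltSE n) (listSE n) (listSE_nodup n) (3*n+1) (by
    intro p hp
    rw [listSE_mem, mem_cellsP] at hp
    unfold ltSE; omega) (wSE n k) (cellsP n) (by rw [← hl]; congr!) (NCse k)
    (fun F G h hG T hT => hG T (hT.trans h))
    (by
      intro F hF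
      constructor
      · intro h
        have := se_D2 n k hk F h
        convert this
      · intro h
        apply se_D1 n k hk F hF
        convert h)
  rw [hl, ← hfc]
  congr 1
  ext F
  simp only [Finset.mem_filter, Finset.mem_powerset]
  apply and_congr_right
  intro hF
  rw [reduce seLen (cellsP n) k seLen_insert (hk.trans (seLen_cells n)) F hF]
  simp only [seLen_le]
  apply and_congr_right
  intro _
  apply forall_congr'; intro c
  apply forall_congr'; intro _
  apply forall_congr'; intro _
  have : insert c F = @insert _ _ (@Finset.instInsert _ (fun a b => Classical.propDecidable (a = b))) c F := by
    congr!
  rw [this]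

theorem final (n k : ℕ) (hn : 0 < n)
    (hmain : k ≤ n →
      ((listNE n).toFinset.powerset.filter fun S => ValidW ltNE S (listNE n) (wNE n k)).card =
      ((listSE n).toFinset.powerset.filter fun S => ValidW (ltSE n) S (listSE n) (wSE n k)).card) :
    ((cellsP n).powerset.filter fun F => neLen F = k ∧
        ∀ c ∈ cellsP n, c ∉ F → neLen F < neLen (insert c F)).card =
    ((cellsP n).powerset.filter fun F => seLen F = k ∧
        ∀ c ∈ cellsP n, c ∉ F → seLen F < seLen (insert c F)).card := by
  by_cases hk : k ≤ n
  · rw [ne_count n k hn hk, se_count n k hk, hmain hk]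
  · rw [Finset.filter_false_of_mem, Finset.filter_false_of_mem]
    · intro F hF h
      have := seLen_le_n n F (Finset.mem_powerset.1 hF)
      omega
    · intro F hF h
      have := neLen_le_n n F (Finset.mem_powerset.1 hF)
      omega

end MaxFill

namespace MaxFill
variable {R : Type*} [CommRing R]

abbrev Fn (R : Type*) := (ℕ → ℕ) → R

def Uop (R : Type*) [CommRing R] (i : ℕ) : Module.End R (Fn R) where
  toFun f := fun u => if u (i+1) < u i then f (swp u i) else 0
  map_add' f g := by
    funext u; simp only [Pi.add_apply]; split_ifs <;> simp
  map_smul' a f := by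
    funext u; simp only [Pi.smul_apply, RingHom.id_apply]; split_ifs <;> simp

lemma Uop_apply (i : ℕ) (f : Fn R) (u : ℕ → ℕ) :
    Uop R i f u = if u (i+1) < u i then f (swp u i) else 0 := rfl

lemma Uop_sq (i : ℕ) : Uop R i * Uop R i = 0 := by
  ext f u
  simp only [Module.End.mul_apply, Uop_apply, LinearMap.zero_apply, Pi.zero_apply]
  split_ifs with h1 h2
  · simp [swp] at h2; omega
  · rfl
  · rfl

lemma swp_comm (u : ℕ → ℕ) (i j : ℕ) (h : i + 2 ≤ j) : swp (swp u i) j = swp (swp u j) i := by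
  funext x
  rw [swp_sig, swp_sig, swp_sig, swp_sig]
  congr 1
  unfold sig
  split_ifs <;> omega

lemma Uop_far (i j : ℕ) (h : i + 2 ≤ j) : Uop R i * Uop R j = Uop R j * Uop R i := by
  ext f u
  simp only [Module.End.mul_apply, Uop_apply]
  have e1 : swp u i j = u j := by unfold swp; rw [if_neg (by omega), if_neg (by omega)]
  have e2 : swp u i (j+1) = u (j+1) := by unfold swp; rw [if_neg (by omega), if_neg (by omega)]
  have e3 : swp u j i = u i := by unfold swp; rw [if_neg (by omega), if_neg (by omega)]
  have e4 : swp u j (i+1) = u (i+1) := by unfold swp; rw [if_neg (by omega), if_neg (by omega)]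
  rw [e1, e2, e3, e4, swp_comm u i j h]
  split_ifs <;> rfl

lemma swp_braid (u : ℕ → ℕ) (i : ℕ) :
    swp (swp (swp u i) (i+1)) i = swp (swp (swp u (i+1)) i) (i+1) := by
  funext x
  simp only [swp_sig]
  congr 1
  unfold sig
  split_ifs <;> omega

lemma Uop_braid (i : ℕ) :
    Uop R i * Uop R (i+1) * Uop R i = Uop R (i+1) * Uop R i * Uop R (i+1) := by
  ext f u
  simp only [Module.End.mul_apply, Uop_apply]
  rw [swp_braid u i]
  have a1 : swp u i (i+1) = u i := by simp [swp]
  have a2 : swp u i (i+1+1) = u (i+1+1) := by simp [swp]; try omega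
  have a3 : swp (swp u i) (i+1) i = u (i+1) := by simp [swp]; try omega
  have a4 : swp (swp u i) (i+1) (i+1) = u (i+1+1) := by simp [swp]; try omega
  have b1 : swp u (i+1) (i+1) = u (i+1+1) := by simp [swp]
  have b2 : swp u (i+1) i = u i := by simp [swp]; try omega
  have b3 : swp (swp u (i+1)) i (i+1+1) = u (i+1) := by simp [swp]; try omega
  have b4 : swp (swp u (i+1)) i (i+1) = u i := by simp [swp]; try omega
  rw [a1, a2, a3, a4, b1, b2, b3, b4]
  split_ifs <;> first | rfl | omega

def hop (i : ℕ) (a : R) : Module.End R (Fn R) := 1 + a • Uop R i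

lemma hop_apply (i : ℕ) (a : R) (f : Fn R) (u : ℕ → ℕ) :
    hop i a f u = f u + if u (i+1) < u i then a * f (swp u i) else 0 := by
  simp only [hop, LinearMap.add_apply, Module.End.one_apply, LinearMap.smul_apply, Pi.add_apply,
    Pi.smul_apply, Uop_apply, smul_eq_mul]
  split_ifs <;> simp

lemma hop_mul (i : ℕ) (a b : R) : hop i a * hop i b = hop i (a+b) := by
  unfold hop
  simp only [mul_add, add_mul, mul_one, one_mul, smul_mul_assoc, mul_smul_comm, Uop_sq, smul_zero]
  module

lemma hop_zero (i : ℕ) : hop i (0:R) = 1 := by simp [hop]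

lemma hop_far (i j : ℕ) (h : i + 2 ≤ j) (a b : R) : hop i a * hop j b = hop j b * hop i a := by
  unfold hop
  simp only [mul_add, add_mul, mul_one, one_mul, smul_mul_assoc, mul_smul_comm, Uop_far i j h]
  module

lemma hop_YB (i : ℕ) (a b : R) :
    hop i a * hop (i+1) (a+b) * hop i b = hop (i+1) b * hop i (a+b) * hop (i+1) a := by
  unfold hop
  simp only [mul_add, add_mul, mul_one, one_mul, smul_mul_assoc, mul_smul_comm, Uop_sq,
    Uop_braid, smul_zero]
  module

def rowA : ℕ → ℕ → R → Module.End R (Fn R)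
  | _, 0, _ => 1
  | lo, c+1, a => rowA (lo+1) c a * hop lo a

lemma rowA_far (i lo c : ℕ) (h : i + 2 ≤ lo) (a b : R) :
    hop i a * rowA lo c b = rowA lo c b * hop i a := by
  induction c generalizing lo with
  | zero => simp [rowA]
  | succ c ih =>
    simp only [rowA]
    rw [← mul_assoc, ih _ (by omega), mul_assoc, hop_far i lo h, mul_assoc]

lemma rowA_neg (lo c : ℕ) (a : R) : rowA lo (c+1) a * hop lo (-a) = rowA (lo+1) c a := by
  simp only [rowA]
  rw [mul_assoc, hop_mul, add_neg_cancel, hop_zero, mul_one]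

lemma rowA_comm (lo c : ℕ) (a b : R) :
    rowA lo c a * rowA lo c b = rowA lo c b * rowA lo c a := by
  induction c generalizing lo with
  | zero => simp [rowA]
  | succ c ih =>
    cases c with
    | zero => simp only [rowA, one_mul]; rw [hop_mul, hop_mul, add_comm]
    | succ c =>
      have key : rowA lo (c+2) a * rowA lo (c+2) b * hop lo (-a) =
          rowA lo (c+2) b * rowA lo (c+2) a * hop lo (-a) := by
        have yb := hop_YB lo a (b-a)
        rw [add_sub_cancel] at yb
        calc rowA lo (c+2) a * rowA lo (c+2) b * hop lo (-a)
            = rowA (lo+1) (c+1) a * (hop lo a * rowA (lo+2) c b) * hop (lo+1) b *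
              (hop lo b * hop lo (-a)) := by
              simp only [rowA, mul_assoc]
          _ = rowA (lo+1) (c+1) a * rowA (lo+2) c b *
              (hop lo a * hop (lo+1) b * hop lo (b-a)) := by
              rw [rowA_far lo (lo+2) c le_rfl, hop_mul, ← sub_eq_add_neg]
              simp only [mul_assoc]
          _ = rowA (lo+1) (c+1) a * (rowA (lo+2) c b * hop (lo+1) (b-a)) *
              (hop lo b * hop (lo+1) a) := by
              rw [yb]; simp only [mul_assoc]
          _ = rowA (lo+1) (c+1) a * rowA (lo+1) (c+1) b * hop (lo+1) (-a) *
              (hop lo b * hop (lo+1) a) := by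
              rw [sub_eq_add_neg, ← hop_mul]; simp only [rowA, mul_assoc]
          _ = rowA (lo+1) (c+1) b * (rowA (lo+1) (c+1) a * hop (lo+1) (-a)) *
              (hop lo b * hop (lo+1) a) := by
              rw [ih (lo+1)]; simp only [mul_assoc]
          _ = rowA (lo+1) (c+1) b * (rowA (lo+2) c a * hop lo b) * hop (lo+1) a := by
              rw [rowA_neg]; simp only [mul_assoc]
          _ = rowA lo (c+2) b * rowA (lo+1) (c+1) a := by
              rw [← rowA_far lo (lo+2) c le_rfl]; simp only [rowA, mul_assoc]
          _ = rowA lo (c+2) b * rowA lo (c+2) a * hop lo (-a) := by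
              rw [mul_assoc, rowA_neg]
      have h2 := congrArg (fun z => z * hop lo a) key
      simpa only [mul_assoc, hop_mul, neg_add_cancel, hop_zero, mul_one] using h2

lemma rowA_step (lo c : ℕ) (a b : R) :
    (a - b) • (rowA lo (c+1) a * rowA lo (c+1) b) =
      a • (rowA lo (c+1) a * rowA (lo+1) c b) - b • (rowA lo (c+1) b * rowA (lo+1) c a) := by
  rw [← rowA_neg lo c a, ← rowA_neg lo c b, ← mul_assoc, ← mul_assoc, rowA_comm lo (c+1) b a]
  unfold hop
  simp only [mul_add, mul_one, mul_smul_comm]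
  module

lemma rowA_append (lo c d : ℕ) (a : R) : rowA lo (c+d) a = rowA (lo+c) d a * rowA lo c a := by
  induction c generalizing lo with
  | zero => simp [rowA]
  | succ c ih =>
    rw [show c + 1 + d = c + d + 1 by omega]
    simp only [rowA]
    rw [ih, show lo + 1 + c = lo + (c+1) by omega, mul_assoc]

/-- congruence on an invariant set -/
lemma rowA_congr (P : (ℕ → ℕ) → Prop) (lo c : ℕ) (a : R)
    (hP : ∀ u, P u → ∀ l, lo ≤ l → l < lo + c → u (l+1) < u l → P (swp u l))
    (f g : Fn R) (hfg : ∀ u, P u → f u = g u) :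
    ∀ u, P u → rowA lo c a f u = rowA lo c a g u := by
  induction c generalizing lo f g with
  | zero => simpa [rowA] using hfg
  | succ c ih =>
    simp only [rowA, Module.End.mul_apply]
    apply ih
    · intro u hu l h1 h2; exact hP u hu l (by omega) (by omega)
    · intro u hu
      rw [hop_apply, hop_apply, hfg u hu]
      split_ifs with h
      · rw [hfg _ (hP u hu lo le_rfl (by omega) h)]
      · rfl

lemma rowA_inc (lo c : ℕ) (a : R) (f : Fn R) (u : ℕ → ℕ)
    (h : ∀ l, lo ≤ l → l < lo + c → ¬ u (l+1) < u l) : rowA lo c a f u = f u := by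
  induction c generalizing lo f with
  | zero => simp [rowA]
  | succ c ih =>
    simp only [rowA, Module.End.mul_apply]
    rw [ih, hop_apply, if_neg (h lo le_rfl (by omega)), add_zero]
    intro l h1 h2; exact h l (by omega) (by omega)

def del (R : Type*) [CommRing R] : Fn R := fun u => if u = id then 1 else 0

def Fix (m : ℕ) (f : Fn R) : Prop := ∀ v : ℕ → ℕ, (∃ j < m, v j ≠ j) → f v = 0

lemma Fix.mono {m m' : ℕ} (h : m' ≤ m) {f : Fn R} (hf : Fix m f) : Fix m' f := by
  rintro v ⟨j, hj, hv⟩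
  exact hf v ⟨j, by omega, hv⟩

lemma Fix_del (m : ℕ) : Fix m (del R) := by
  rintro v ⟨j, _, hv⟩
  unfold del
  rw [if_neg]
  rintro rfl
  exact hv rfl

lemma Fix_rowA (m lo c : ℕ) (h : m ≤ lo) (a : R) (f : Fn R) (hf : Fix m f) :
    Fix m (rowA lo c a f) := by
  rintro v hv
  have := rowA_congr (R := R) (fun v => ∃ j < m, v j ≠ j) lo c a (by
    rintro u ⟨j, hj, hu⟩ l h1 _ _
    refine ⟨j, hj, ?_⟩
    unfold swp
    rwa [if_neg (by omega), if_neg (by omega)]) f 0 (fun u hu => hf u hu) v hv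
  rw [this]; simp

def Reach (D : ℕ → Prop) (u : ℕ → ℕ) : Prop := ∀ a b, a < b → u b < u a → D (u b)

lemma Reach_swp (D : ℕ → Prop) (u : ℕ → ℕ) (hu : Reach D u) (l : ℕ) (hl : u (l+1) < u l) :
    Reach D (swp u l) := by
  intro a b hab h
  by_cases hc : a = l ∧ b = l+1
  · obtain ⟨rfl, rfl⟩ := hc
    simp [swp] at h
    omega
  · rw [swp_sig, swp_sig] at h
    rw [swp_sig]
    exact hu _ _ (sig_lt_sig l a b hab hc) h

lemma useless (D : ℕ → Prop) (u : ℕ → ℕ) (hu : Reach D u) (l : ℕ) (hl : ¬ D l) (a : R) (f : Fn R)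
    (hf : Fix (l+1) f) : hop l a f u = f u := by
  rw [hop_apply]
  split_ifs with h
  · have : f (swp u l) = 0 := by
      apply hf
      refine ⟨l, by omega, ?_⟩
      intro he
      simp [swp] at he
      apply hl
      have := hu l (l+1) (by omega) h
      rwa [he] at this
    rw [this]; simp
  · simp

lemma rowA_reach_congr (D : ℕ → Prop) (lo c : ℕ) (a : R) (f g : Fn R)
    (hfg : ∀ u, Reach D u → f u = g u) :
    ∀ u, Reach D u → rowA lo c a f u = rowA lo c a g u :=
  rowA_congr _ lo c a (fun u hu l _ _ h => Reach_swp D u hu l h) f g hfg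

lemma useless_row (D : ℕ → Prop) (lo d c : ℕ) (a : R) (f : Fn R) (hf : Fix (lo+d) f)
    (hD : ∀ l, lo ≤ l → l < lo + d → ¬ D l) :
    ∀ u, Reach D u → rowA lo (d+c) a f u = rowA (lo+d) c a f u := by
  induction d generalizing lo with
  | zero => simp
  | succ d ih =>
    intro u hu
    rw [show d + 1 + c = d + c + 1 by omega]
    simp only [rowA, Module.End.mul_apply]
    rw [rowA_reach_congr D _ _ _ _ f (fun v hv => useless D v hv lo (hD lo le_rfl (by omega)) a f
      (hf.mono (by omega))) u hu]
    rw [ih (lo+1) (by rwa [show lo + 1 + d = lo + (d+1) by omega])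
      (fun l h1 h2 => hD l (by omega) (by omega)) u hu]
    rw [show lo + 1 + d = lo + (d+1) by omega]

lemma useless_all (D : ℕ → Prop) (lo c : ℕ) (a : R)
    (hD : ∀ l, lo ≤ l → ¬ D l) :
    ∀ u, Reach D u → rowA lo c a (del R) u = del R u := by
  intro u hu
  have := useless_row D lo c 0 a (del R) (Fix_del _) (fun l h1 _ => hD l h1) u hu
  simpa [rowA] using this

end MaxFill

namespace MaxFill
variable {R : Type*} [CommRing R]

def cyc (u : ℕ → ℕ) (e q : ℕ) : ℕ → ℕ :=
  fun j => if j = e then u q else if e < j ∧ j ≤ q then u (j-1) else u j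

lemma cyc_self (u : ℕ → ℕ) (e : ℕ) : cyc u e e = u := by
  funext j
  unfold cyc
  split_ifs with h1 h2
  · rw [h1]
  · omega
  · rfl

lemma cyc_swp (u : ℕ → ℕ) (e d : ℕ) : cyc (swp u (e+d)) e (e+d) = cyc u e (e+d+1) := by
  funext j
  unfold cyc swp
  by_cases h1 : j = e
  · simp [h1]
  · rw [if_neg h1, if_neg h1]
    by_cases h2 : e < j ∧ j ≤ e + d
    · rw [if_pos h2, if_neg (by omega), if_neg (by omega), if_pos (by omega)]
    · rw [if_neg h2]
      by_cases h3 : j = e + d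
      · omega
      rw [if_neg h3]
      by_cases h4 : j = e+d+1
      · rw [if_pos h4, if_pos (by omega)]
        congr 1; omega
      · rw [if_neg h4, if_neg (by omega)]

lemma base_cyc (e d : ℕ) (x : R) (f : Fn R) (hf : Fix (e+1) f) (v : ℕ → ℕ) (h1 : v (e+d) = e)
    (h2 : ∀ j < e+d, v j ≠ e) (h3 : ∀ j, e ≤ j → j < e+d → e < v j) :
    rowA e d x f v = x^d * f (cyc v e (e+d)) := by
  induction d generalizing v with
  | zero => simp [rowA, cyc_self]
  | succ d ih =>
    rw [rowA_append e d 1]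
    simp only [rowA, one_mul, Module.End.mul_apply]
    rw [hop_apply]
    have hz : rowA e d x f v = 0 := by
      have := rowA_congr (R := R) (fun v => ∀ j < e+d+1, v j ≠ e) e d x (by
        intro u hu l hl1 hl2 _ j hj
        rw [swp_sig]
        apply hu
        unfold sig
        split_ifs <;> omega) f 0 (by
          intro u hu
          exact hf u ⟨e, by omega, hu e (by omega)⟩) v h2
      rw [this]; simp
    have hd : v (e+d+1) < v (e+d) := by
      have := h3 (e+d) (by omega) (by omega)
      rw [show e + d + 1 = e + (d+1) by omega, h1]
      exact this
    rw [hz, if_pos hd, zero_add, ih]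
    · rw [cyc_swp, pow_succ]
      rw [show e + (d+1) = e + d + 1 by omega]
      ring
    · simp only [swp, if_true]
      exact h1
    · intro j hj
      simp only [swp]
      rw [if_neg (by omega), if_neg (by omega)]
      exact h2 j (by omega)
    · intro j hj1 hj
      simp only [swp]
      rw [if_neg (by omega), if_neg (by omega)]
      exact h3 j hj1 (by omega)

structure Setup (M N : ℕ) (D : ℕ → Prop) (e q : ℕ → ℕ) (W : ℕ → ℕ → ℕ) : Prop where
  e_lt : ∀ i, 1 ≤ i → i ≤ M → e i < e (i+1)
  e_top : e (M+1) ≤ N+1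
  notD : ∀ i, 1 ≤ i → i ≤ M → ∀ l, e i < l → l < e (i+1) → ¬ D l
  notDtop : ∀ l, e (M+1) ≤ l → ¬ D l
  reach : Reach D (W 0)
  diff : ∀ i, i < M → q (i+1) = e (i+1) + (2*M-(i+1))
  qN : ∀ i, i < M → q (i+1) ≤ N+1
  b1 : ∀ i, i < M → W i (q (i+1)) = e (i+1)
  b2 : ∀ i, i < M → ∀ j < q (i+1), W i j ≠ e (i+1)
  b3 : ∀ i, i < M → ∀ j, e (i+1) ≤ j → j < q (i+1) → e (i+1) < W i j
  b4 : ∀ i, i < M → ∀ l, q (i+1) ≤ l → l ≤ N → ¬ W i (l+1) < W i l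
  b5 : ∀ i, i < M → cyc (W i) (e (i+1)) (q (i+1)) = W (i+1)
  WM : W M = id

def valF (N : ℕ) (e : ℕ → ℕ) : List (ℕ × R) → Fn R
  | [] => del R
  | p :: L => rowA (e p.1) (N + 1 - e p.1) p.2 (valF N e L)

def valG (N : ℕ) (e : ℕ → ℕ) : List (ℕ × R) → Module.End R (Fn R)
  | [] => 1
  | p :: L => rowA (e p.1) (N + 1 - e p.1) p.2 * (valG N e L)

lemma valF_append (N : ℕ) (e : ℕ → ℕ) (G L : List (ℕ × R)) :
    valF N e (G ++ L) = valG N e G (valF N e L) := by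
  induction G with
  | nil => rfl
  | cons p G ih => simp [valF, valG, ih]

lemma valG_congr (N : ℕ) (e : ℕ → ℕ) (D : ℕ → Prop) (G : List (ℕ × R)) (f g : Fn R)
    (hfg : ∀ u, Reach D u → f u = g u) :
    ∀ u, Reach D u → valG N e G f u = valG N e G g u := by
  induction G with
  | nil => exact hfg
  | cons p G ih =>
    simp only [valG, Module.End.mul_apply]
    exact rowA_reach_congr D _ _ _ _ _ ih

lemma Fix_valF (N : ℕ) (e : ℕ → ℕ) (m : ℕ) (L : List (ℕ × R)) (h : ∀ p ∈ L, m ≤ e p.1) :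
    Fix m (valF N e L) := by
  induction L with
  | nil => exact Fix_del m
  | cons p L ih =>
    exact Fix_rowA _ _ _ (h p (by simp)) _ _ (ih (fun r hr => h r (by simp [hr])))

variable {M N : ℕ} {D : ℕ → Prop} {e q : ℕ → ℕ} {W : ℕ → ℕ → ℕ}

lemma Setup.mono (S : Setup M N D e q W) (i j : ℕ) (hi : 1 ≤ i) (hij : i ≤ j) (hj : j ≤ M+1) :
    e i ≤ e j := by
  induction j, hij using Nat.le_induction with
  | base => exact le_rfl
  | succ j hij ih =>
    have := ih (by omega)
    have := S.e_lt j (by omega) (by omega)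
    omega

lemma Setup.step (S : Setup M N D e q W) (i : ℕ) (hi : 1 ≤ i) (hM : i ≤ M) (G L : List (ℕ × R))
    (hL : ∀ p ∈ L, i + 1 ≤ p.1 ∧ p.1 ≤ M+1) (a b : R) (u : ℕ → ℕ) (hu : Reach D u) :
    (a - b) * valF N e (G ++ (i,a) :: (i,b) :: L) u =
      a * valF N e (G ++ (i,a) :: (i+1,b) :: L) u -
      b * valF N e (G ++ (i,b) :: (i+1,a) :: L) u := by
  have hlt := S.e_lt i hi hM
  have hN : e (i+1) ≤ N + 1 := (S.mono (i+1) (M+1) (by omega) (by omega) le_rfl).trans S.e_top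
  have hfix : Fix (e (i+1)) (valF N e L) := by
    apply Fix_valF
    intro p hp
    exact S.mono _ _ (by omega) (hL p hp).1 (hL p hp).2
  have hrow : ∀ (x : R) v, Reach D v → rowA (e i + 1) (N - e i) x (valF N e L) v =
      rowA (e (i+1)) (N + 1 - e (i+1)) x (valF N e L) v := by
    intro x v hv
    have := useless_row D (e i + 1) (e (i+1) - (e i + 1)) (N + 1 - e (i+1)) x (valF N e L)
      (by rwa [show e i + 1 + (e (i+1) - (e i + 1)) = e (i+1) by omega])
      (fun l h1 h2 => S.notD i hi hM l (by omega) (by omega)) v hv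
    rw [show e i + 1 + (e (i+1) - (e i + 1)) = e (i+1) by omega,
      show e (i+1) - (e i + 1) + (N + 1 - e (i+1)) = N - e i by omega] at this
    exact this
  have key := rowA_step (R := R) (e i) (N - e i) a b
  rw [show N - e i + 1 = N + 1 - e i by omega] at key
  have key2 := congrArg (fun Z => valG N e G (Z (valF N e L)) u) key
  simp only [LinearMap.smul_apply, LinearMap.sub_apply, Module.End.mul_apply, map_smul, map_sub,
    Pi.smul_apply, Pi.sub_apply, smul_eq_mul] at key2
  rw [valF_append, valF_append, valF_append]
  simp only [valF]
  rw [key2]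
  congr 2
  · apply valG_congr N e D G _ _ _ u hu
    apply rowA_reach_congr
    exact hrow b
  · apply valG_congr N e D G _ _ _ u hu
    apply rowA_reach_congr
    exact hrow a

lemma Setup.drop (S : Setup M N D e q W) (G : List (ℕ × R)) (x : R) (u : ℕ → ℕ)
    (hu : Reach D u) : valF N e (G ++ [(M+1, x)]) u = valF N e G u := by
  have : valF N e G = valF N e (G ++ []) := by simp
  rw [this, valF_append, valF_append]
  apply valG_congr N e D G _ _ _ u hu
  intro v hv
  simp only [valF]
  exact useless_all D _ _ _ S.notDtop v hv

def baseProd (M : ℕ) : List (ℕ × R) → R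
  | [] => 1
  | p :: L => p.2 ^ (2*M - p.1) * baseProd M L

lemma Setup.base (S : Setup M N D e q W) (i : ℕ) (hi : i ≤ M) (L : List (ℕ × R))
    (hL : L.map Prod.fst = List.range' (i+1) (M-i)) :
    valF N e L (W i) = baseProd M L := by
  induction L generalizing i with
  | nil =>
    have : M = i := by
      by_contra hne
      have := congrArg List.length hL
      simp at this; omega
    subst this
    rw [S.WM]
    simp [valF, del, baseProd]
  | cons p L ih =>
    have hlt : i < M := by
      have := congrArg List.length hL
      simp at this; omega
    rw [show M - i = (M - (i+1)) + 1 by omega, List.range'_succ, List.map_cons,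
      List.cons.injEq] at hL
    obtain ⟨hp, hL⟩ := hL
    simp only [valF, baseProd]
    rw [← ih (i+1) (by omega) hL, hp, ← S.b5 i hlt]
    have hq := S.diff i hlt
    have hqN := S.qN i hlt
    have hb1 := S.b1 i hlt
    have hb2 := S.b2 i hlt
    have hb3 := S.b3 i hlt
    rw [show N + 1 - e (i+1) = (2*M-(i+1)) + (N+1 - q (i+1)) by omega, rowA_append,
      Module.End.mul_apply, rowA_inc]
    · rw [hq] at hb1 hb2 hb3 ⊢
      apply base_cyc _ _ _ _ _ _ hb1 hb2 hb3
      apply Fix_valF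
      intro r hr
      have hmem : r.1 ∈ L.map Prod.fst := List.mem_map_of_mem hr
      rw [hL, List.mem_range'_1] at hmem
      have := S.e_lt (i+1) (by omega) (by omega)
      have := S.mono (i+1+1) r.1 (by omega) (by omega) (by omega)
      omega
    · intro l h1 h2
      exact S.b4 i hlt l (by omega) (by omega)

section main
variable {N' : ℕ} {D' : ℕ → Prop} {e' q' : ℕ → ℕ} {W' : ℕ → ℕ → ℕ}

lemma main_step [IsDomain R] (S : Setup M N D e q W) (S' : Setup M N' D' e' q' W') (G : List ℕ) (i : ℕ)
    (hi : 1 ≤ i) (hM : i ≤ M)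
    (ih : ∀ L : List (ℕ × R), (L.map Prod.snd).Nodup →
      L.map Prod.fst = G ++ i :: (i+1) :: List.range' (i+1) (M-i) →
      valF N e L (W 0) = valF N' e' L (W' 0)) :
    ∀ L : List (ℕ × R), (L.map Prod.snd).Nodup →
      L.map Prod.fst = G ++ i :: i :: List.range' (i+1) (M-i) →
      valF N e L (W 0) = valF N' e' L (W' 0) := by
  intro L hnd hL
  rw [List.map_eq_append_iff] at hL
  obtain ⟨G', L1, rfl, hG, hL1⟩ := hL
  rw [List.map_eq_cons_iff] at hL1
  obtain ⟨⟨i1, a⟩, L2, rfl, h1, hL2⟩ := hL1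
  rw [List.map_eq_cons_iff] at hL2
  obtain ⟨⟨i2, b⟩, L3, rfl, h2, hL3⟩ := hL2
  simp only at h1 h2
  subst h1 h2
  have hL3' : ∀ p ∈ L3, i2 + 1 ≤ p.1 ∧ p.1 ≤ M+1 := by
    intro p hp
    have hmem : p.1 ∈ L3.map Prod.fst := List.mem_map_of_mem hp
    rw [hL3, List.mem_range'_1] at hmem
    omega
  have s1 := S.step i2 hi hM G' L3 hL3' a b _ S.reach
  have s2 := S'.step i2 hi hM G' L3 hL3' a b _ S'.reach
  have i1' := ih (G' ++ (i2,a) :: (i2+1,b) :: L3) (by simpa using hnd) (by simp [hG, hL3])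
  have hperm : ((G' ++ (i2,b) :: (i2+1,a) :: L3).map Prod.snd).Nodup := by
    refine (List.Perm.nodup_iff ?_).1 hnd
    simp only [List.map_append, List.map_cons]
    exact List.Perm.append_left _ (List.Perm.swap _ _ _)
  have i2' := ih (G' ++ (i2,b) :: (i2+1,a) :: L3) hperm (by simp [hG, hL3])
  have hab : a - b ≠ 0 := by
    intro h
    rw [sub_eq_zero] at h
    subst h
    rw [List.map_append, List.nodup_append] at hnd
    simp at hnd
  apply mul_left_cancel₀ hab
  rw [s1, s2, i1', i2']

lemma main_eq [IsDomain R] (S : Setup M N D e q W) (S' : Setup M N' D' e' q' W') (s : ℕ) :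
    ∀ L : List (ℕ × R), (L.map Prod.snd).Nodup →
      L.map Prod.fst = List.replicate s 1 ++ List.range' 1 M →
      valF N e L (W 0) = valF N' e' L (W' 0) := by
  induction s with
  | zero =>
    intro L _ hL
    simp only [List.replicate_zero, List.nil_append] at hL
    rw [S.base 0 (by omega) L (by simpa using hL), S'.base 0 (by omega) L (by simpa using hL)]
  | succ s ih =>
    have Q : ∀ d ≤ M, ∀ L : List (ℕ × R), (L.map Prod.snd).Nodup →
        L.map Prod.fst = List.replicate s 1 ++ (List.range' 1 (M+1-d) ++ List.range' (M+1-d) d) →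
        valF N e L (W 0) = valF N' e' L (W' 0) := by
      intro d
      induction d with
      | zero =>
        intro _ L hnd hL
        simp only [Nat.sub_zero, List.range'_zero, List.append_nil, List.range'_concat,
          ← List.append_assoc] at hL
        rw [List.map_eq_append_iff] at hL
        obtain ⟨G, L1, rfl, hG, hL1⟩ := hL
        rw [List.map_eq_cons_iff] at hL1
        obtain ⟨⟨i1, a⟩, L2, rfl, h1, hL2⟩ := hL1
        simp only [List.map_eq_nil_iff] at hL2
        subst hL2
        simp only [one_mul] at h1
        rw [show i1 = M + 1 by omega]
        rw [S.drop G a _ S.reach, S'.drop G a _ S'.reach]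
        apply ih G _ hG
        rw [List.map_append, List.nodup_append] at hnd
        exact hnd.1
      | succ d ihd =>
        intro hd L hnd hL
        have e1 : List.range' 1 (M+1-(d+1)) = List.range' 1 (M-(d+1)) ++ [M-d] := by
          rw [show M+1-(d+1) = (M-(d+1)) + 1 by omega, List.range'_concat]
          congr 2; omega
        have e2 : List.range' (M+1-(d+1)) (d+1) = (M-d) :: List.range' (M-d+1) (M-(M-d)) := by
          rw [List.range'_succ, show M+1-(d+1) = M-d by omega, show M-(M-d) = d by omega]
        have e3 : List.range' 1 (M+1-d) ++ List.range' (M+1-d) d =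
            List.range' 1 (M-(d+1)) ++ (M-d) :: (M-d+1) :: List.range' (M-d+1) (M-(M-d)) := by
          rw [show M+1-d = (M-(d+1)) + 1 + 1 by omega, List.range'_concat, List.range'_concat]
          simp only [List.append_assoc, List.cons_append, List.nil_append]
          rw [show 1+1*(M-(d+1)) = M-d by omega, show 1+1*(M-(d+1)+1) = M-d+1 by omega,
            show M-(M-d) = d by omega, show M-(d+1)+1+1 = M-d+1 by omega]
        refine main_step S S' (List.replicate s 1 ++ List.range' 1 (M-(d+1))) (M-d) (by omega)
          (by omega) ?_ L hnd ?_
        · intro L' hnd' hL'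
          apply ihd (by omega) L' hnd'
          rw [hL', e3, List.append_assoc]
        · rw [hL, e1, e2]
          simp only [List.append_assoc, List.cons_append, List.nil_append]
    intro L hnd hL
    apply Q M le_rfl L hnd
    rw [hL, show M + 1 - M = 1 by omega, List.replicate_succ']
    simp
end main

/-- naturality -/
lemma rowA_map {R' : Type*} [CommRing R'] (φ : R →+* R') (lo c : ℕ) (a : R) (f : Fn R)
    (u : ℕ → ℕ) : rowA lo c (φ a) (fun v => φ (f v)) u = φ (rowA lo c a f u) := by
  induction c generalizing lo f u with
  | zero => simp [rowA]
  | succ c ih =>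
    simp only [rowA, Module.End.mul_apply]
    rw [← ih]
    have hh : (hop lo (φ a)) (fun v => φ (f v)) = fun v => φ (hop lo a f v) := by
      funext v
      rw [hop_apply, hop_apply]
      split_ifs <;> simp
    rw [hh]

lemma valF_map {R' : Type*} [CommRing R'] (φ : R →+* R') (N : ℕ) (e : ℕ → ℕ) (L : List (ℕ × R))
    (u : ℕ → ℕ) : valF N e (L.map (fun p => (p.1, φ p.2))) u = φ (valF N e L u) := by
  induction L generalizing u with
  | nil => simp only [List.map_nil, valF, del]; split_ifs <;> simp
  | cons p L ih =>
    simp only [List.map_cons, valF]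
    rw [← rowA_map, funext ih]

open Polynomial in
theorem main_one {N' : ℕ} {D' : ℕ → Prop} {e' q' : ℕ → ℕ} {W' : ℕ → ℕ → ℕ}
    (S : Setup M N D e q W) (S' : Setup M N' D' e' q' W') (s : ℕ) :
    valF (R := ℤ) N e ((List.replicate s 1 ++ List.range' 1 M).map (fun g => (g, 1))) (W 0) =
    valF (R := ℤ) N' e' ((List.replicate s 1 ++ List.range' 1 M).map (fun g => (g, 1))) (W' 0) := by
  obtain ⟨g, hg⟩ : ∃ g, g = List.replicate s 1 ++ List.range' 1 M := ⟨_, rfl⟩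
  rw [← hg]
  let xs : List ℤ[X] := (List.range g.length).map (fun i : ℕ => 1 + (i : ℤ[X]) * X)
  let L : List (ℕ × ℤ[X]) := g.zip xs
  have hlen : g.length = xs.length := by simp [xs]
  have h1 : L.map Prod.fst = g := List.map_fst_zip hlen.le
  have h2 : L.map Prod.snd = xs := List.map_snd_zip hlen.ge
  have hnd : (L.map Prod.snd).Nodup := by
    rw [h2]
    apply List.Nodup.map _ List.nodup_range
    intro i j hij
    have h3 : (1 + (i : ℤ[X]) * X) = 1 + (j : ℤ[X]) * X := hij
    have h4 := congrArg (Polynomial.eval 1) h3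
    simpa using h4
  have h3 : L.map (fun p => (p.1, Polynomial.evalRingHom (0:ℤ) p.2)) = g.map (fun g => (g, 1)) := by
    rw [← h1, List.map_map]
    apply List.map_congr_left
    intro p hp
    have : p.2 ∈ L.map Prod.snd := List.mem_map_of_mem hp
    rw [h2, List.mem_map] at this
    obtain ⟨i, _, hi⟩ := this
    simp [← hi]
  rw [← h3, valF_map, valF_map, main_eq S S' s L hnd (by rw [h1, hg])]

end MaxFill

namespace MaxFill

/-! Setup instances -/

def WSE (n k i j : ℕ) : ℕ :=
  if j ≤ k+i then j else if j ≤ n+i then j+n-k-i else if j ≤ 2*n-k then 2*n+1+i-j else j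

def WNE (n k i j : ℕ) : ℕ :=
  if j ≤ 2*k+2*i then j else if j ≤ n+k+i then 2*j-2*k-2*i else if j ≤ 2*n-1+i then j+n-k-i
  else if j ≤ 3*n-k-1 then 2*j+2*k+1-4*n else j

lemma WSE_zero (n k : ℕ) (h : k ≤ n) : WSE n k 0 = wSE n k := by
  funext j
  unfold WSE wSE
  split_ifs <;> omega

lemma WNE_zero (n k : ℕ) (h : k ≤ n) : WNE n k 0 = wNE n k := by
  funext j
  unfold WNE wNE
  split_ifs <;> omega

lemma setupSE (n k : ℕ) (hn : 0 < n) (h : k ≤ n) :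
    Setup (n-k) (2*n-1) (fun l => k < l ∧ l ≤ n) (fun i => k+i) (fun _ => 2*n-k) (WSE n k) where
  e_lt := by intros; omega
  e_top := by omega
  notD := by intros; omega
  notDtop := by intros; omega
  reach := by
    intro a b hab
    unfold WSE
    split_ifs <;> omega
  diff := by intros; omega
  qN := by intros; omega
  b1 := by
    intro i hi
    unfold WSE
    split_ifs <;> omega
  b2 := by
    intro i hi j hj
    unfold WSE
    split_ifs <;> omega
  b3 := by
    intro i hi j hj hj2
    unfold WSE
    split_ifs <;> omega
  b4 := by
    intro i hi j hj hj2
    unfold WSE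
    split_ifs <;> omega
  b5 := by
    intro i hi
    funext j
    unfold cyc WSE
    split_ifs <;> omega
  WM := by
    funext j
    unfold WSE
    simp only [id]
    split_ifs <;> omega

lemma setupNE (n k : ℕ) (hn : 0 < n) (h : k ≤ n) :
    Setup (n-k) (3*n) (fun l => 2*k < l ∧ l < 2*n ∧ l % 2 = 1) (fun i => 2*k+2*i-1)
      (fun i => 2*n+i-1) (WNE n k) where
  e_lt := by intros; omega
  e_top := by omega
  notD := by intros; omega
  notDtop := by intros; omega
  reach := by
    intro a b hab
    unfold WNE
    split_ifs <;> omega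
  diff := by intros; omega
  qN := by intros; omega
  b1 := by
    intro i hi
    unfold WNE
    split_ifs <;> omega
  b2 := by
    intro i hi j hj
    unfold WNE
    split_ifs <;> omega
  b3 := by
    intro i hi j hj hj2
    unfold WNE
    split_ifs <;> omega
  b4 := by
    intro i hi j hj hj2
    unfold WNE
    split_ifs <;> omega
  b5 := by
    intro i hi
    funext j
    unfold cyc WNE
    split_ifs <;> omega
  WM := by
    funext j
    unfold WNE
    simp only [id]
    split_ifs <;> omega

/-! counting -/

def opL {α : Type*} (lt : α → ℕ) : List α → Module.End ℤ (Fn ℤ)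
  | [] => 1
  | p :: L => hop (lt p) 1 * opL lt L

lemma opL_append {α : Type*} (lt : α → ℕ) (L L' : List α) :
    opL lt (L ++ L') = opL lt L * opL lt L' := by
  induction L with
  | nil => simp [opL]
  | cons p L ih => simp [opL, ih, mul_assoc]

lemma count_opL {α : Type*} [DecidableEq α] (lt : α → ℕ) (L : List α) (hL : L.Nodup) (u : ℕ → ℕ) :
    ((L.toFinset.powerset.filter fun S => ValidW lt S L u).card : ℤ) = opL lt L (del ℤ) u := by
  induction L generalizing u with
  | nil =>
    simp only [opL, Module.End.one_apply, del, ValidW, List.toFinset_nil, Finset.powerset_empty]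
    by_cases hu : u = id
    · simp [hu]
    · simp [hu]
  | cons p L ih =>
    rw [List.nodup_cons] at hL
    have hp : p ∉ L.toFinset := by simpa using hL.1
    simp only [opL, Module.End.mul_apply]
    rw [hop_apply, ← ih hL.2, ← ih hL.2, Finset.card_filter, Finset.card_filter,
      Finset.card_filter, List.toFinset_cons, Finset.sum_powerset_insert hp, Nat.cast_add]
    congr 1
    · congr 1
      apply Finset.sum_congr rfl
      intro t ht
      have hpt : p ∉ t := fun h => hp (Finset.mem_powerset.1 ht h)
      simp [ValidW, hpt]
    · have key : ∀ t ∈ L.toFinset.powerset, (ValidW lt (insert p t) (p :: L) u ↔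
          u (lt p + 1) < u (lt p) ∧ ValidW lt t L (swp u (lt p))) := by
        intro t ht
        rw [ValidW.congr lt t (insert p t) L]
        · simp [ValidW]
        · intro r hr
          simp only [Finset.mem_insert]
          constructor
          · exact Or.inr
          · rintro (rfl | h)
            · exact absurd hr hL.1
            · exact h
      split_ifs with hd
      · rw [one_mul]
        congr 1
        apply Finset.sum_congr rfl
        intro t ht
        simp only [key t ht, hd, true_and]
      · rw [Finset.sum_eq_zero]
        · rfl
        · intro t ht
          rw [if_neg]
          rw [key t ht]
          tauto

lemma opL_row {α : Type*} (lt : α → ℕ) (cell : ℕ → α) (hi : ℕ) (t : ℕ) (ht : t ≤ hi + 1)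
    (hlt : ∀ s < t, lt (cell s) = hi - s) :
    opL lt ((List.range t).map cell) = rowA (hi+1-t) t 1 := by
  induction t with
  | zero => simp [opL, rowA]
  | succ t ih =>
    rw [List.range_succ, List.map_append, opL_append, ih (by omega) (fun s hs => hlt s (by omega))]
    simp only [List.map_cons, List.map_nil, opL, mul_one, rowA]
    rw [hlt t (by omega), show hi + 1 - (t+1) + 1 = hi + 1 - t by omega,
      show hi + 1 - (t+1) = hi - t by omega]

def rowsOp (lo len : ℕ → ℕ) : List ℕ → Fn ℤ
  | [] => del ℤ
  | y :: L => rowA (lo y) (len y) 1 (rowsOp lo len L)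

lemma opL_rows {α : Type*} (lt : α → ℕ) (cell : ℕ → ℕ → α) (lo len : ℕ → ℕ) (ys : List ℕ)
    (hrow : ∀ y ∈ ys, opL lt ((List.range (len y)).map (cell y)) = rowA (lo y) (len y) 1) :
    opL lt (ys.flatMap (fun y => (List.range (len y)).map (cell y))) (del ℤ) =
      rowsOp lo len ys := by
  induction ys with
  | nil => simp [opL, rowsOp]
  | cons y ys ih =>
    rw [List.flatMap_cons, opL_append, Module.End.mul_apply,
      ih (fun z hz => hrow z (by simp [hz])), hrow y (by simp)]
    rfl

lemma rowsL_eq {α : Type*} (cell : ℕ → ℕ → α) (len : ℕ → ℕ) (n : ℕ) :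
    rowsL cell len n = (List.range' 1 n).flatMap (fun y => (List.range (len y)).map (cell y)) := by
  rw [rowsL, List.range'_eq_map_range, List.flatMap_map]
  simp only [add_comm]

lemma row_cmp (P : (ℕ → ℕ) → Prop) (lo e hi N : ℕ) (h1 : lo ≤ e) (h3 : hi ≤ N)
    (hP : ∀ u, P u → ∀ l, e ≤ l → l ≤ hi → u (l+1) < u l → P (swp u l))
    (hlow : ∀ u, P u → ∀ l, lo ≤ l → l < e → ¬ u (l+1) < u l)
    (f g : Fn ℤ) (hfg : ∀ u, P u → f u = g u) (u : ℕ → ℕ) (hu : P u)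
    (hup : ∀ l, hi < l → l ≤ N → ¬ u (l+1) < u l) :
    rowA lo (hi+1-lo) 1 f u = rowA e (N+1-e) 1 g u := by
  by_cases h2 : e ≤ hi+1
  swap
  · rw [rowA_inc, rowA_inc, hfg u hu]
    · intro l hl1 hl2
      exact hup l (by omega) (by omega)
    · intro l hl1 hl2
      exact hlow u hu l hl1 (by omega)
  rw [show hi+1-lo = (e-lo) + (hi+1-e) by omega, rowA_append,
    show N+1-e = (hi+1-e) + (N-hi) by omega, rowA_append, Module.End.mul_apply,
    Module.End.mul_apply, rowA_inc (e + (hi+1-e)), show lo + (e-lo) = e by omega]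
  · apply rowA_congr P e (hi+1-e) 1 _ _ _ _ u hu
    · intro u hu l hl1 hl2 hd
      exact hP u hu l hl1 (by omega) hd
    · intro v hv
      rw [rowA_inc, hfg v hv]
      intro l hl1 hl2
      exact hlow v hv l hl1 (by omega)
  · intro l hl1 hl2
    exact hup l (by omega) (by omega)

lemma rows_cmp (Inv : ℕ → (ℕ → ℕ) → Prop) (lo len hi γ e : ℕ → ℕ) (n N : ℕ)
    (hI : ∀ y u, Inv y u → Inv (y+1) u)
    (hlen : ∀ y, 1 ≤ y → y ≤ n → len y = hi y + 1 - lo y)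
    (h1 : ∀ y, 1 ≤ y → y ≤ n → lo y ≤ e (γ y))
    (h3 : ∀ y, 1 ≤ y → y ≤ n → hi y ≤ N)
    (hP : ∀ y, 1 ≤ y → y ≤ n → ∀ u, Inv (y+1) u → ∀ l, e (γ y) ≤ l → l ≤ hi y →
      u (l+1) < u l → Inv (y+1) (swp u l))
    (hlow : ∀ y, 1 ≤ y → y ≤ n → ∀ u, Inv (y+1) u → ∀ l, lo y ≤ l → l < e (γ y) →
      ¬ u (l+1) < u l)
    (hup : ∀ y, 1 ≤ y → y ≤ n → ∀ u, Inv y u → ∀ l, hi y < l → l ≤ N → ¬ u (l+1) < u l)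
    (m y : ℕ) (hy : 1 ≤ y) (hm : y + m = n + 1) (u : ℕ → ℕ) (hu : Inv y u) :
    rowsOp lo len (List.range' y m) u =
      valF N e ((List.range' y m).map (fun y => (γ y, (1:ℤ)))) u := by
  induction m generalizing y u with
  | zero => rfl
  | succ m ih =>
    rw [List.range'_succ, List.map_cons]
    simp only [rowsOp, valF]
    rw [hlen y hy (by omega)]
    exact row_cmp (Inv (y+1)) _ _ _ _ (h1 y hy (by omega))
      (h3 y hy (by omega)) (hP y hy (by omega)) (hlow y hy (by omega)) _ _
      (fun v hv => ih (y+1) (by omega) (by omega) v hv) u (hI y u hu) (hup y hy (by omega) u hu)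

def gam (k y : ℕ) : ℕ := if y ≤ k then 1 else y - k

lemma gam_list (n k : ℕ) (h : k ≤ n) :
    (List.range' 1 n).map (fun y => (gam k y, (1:ℤ))) =
      (List.replicate k 1 ++ List.range' 1 (n-k)).map (fun g => (g, (1:ℤ))) := by
  have : (List.range' 1 n).map (gam k) = List.replicate k 1 ++ List.range' 1 (n-k) := by
    apply List.ext_getElem
    · simp; omega
    · intro i h1 h2
      simp only [List.getElem_map, List.getElem_range', List.getElem_append,
        List.length_replicate, List.getElem_replicate, gam]
      split_ifs <;> omega
  rw [← this, List.map_map]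
  rfl

def Low (κ : ℕ) (u : ℕ → ℕ) : Prop := (∀ j ≤ κ, u j = j) ∧ ∀ j, κ < j → κ < u j

lemma Low.nodesc {κ : ℕ} {u : ℕ → ℕ} (h : Low κ u) (l : ℕ) (hl : l ≤ κ) : ¬ u (l+1) < u l := by
  have h1 := h.1 l hl
  by_cases hc : l + 1 ≤ κ
  · have := h.1 (l+1) hc; omega
  · have := h.2 (l+1) (by omega); omega

lemma Low.swp {κ : ℕ} {u : ℕ → ℕ} (h : Low κ u) (l : ℕ) (hl : κ < l) : Low κ (swp u l) := by
  constructor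
  · intro j hj
    rw [swp_sig, show sig l j = j by unfold sig; split_ifs <;> omega]
    exact h.1 j hj
  · intro j hj
    rw [swp_sig]
    apply h.2
    unfold sig; split_ifs <;> omega

lemma countSE (n k : ℕ) (hn : 0 < n) (h : k ≤ n) :
    (((listSE n).toFinset.powerset.filter fun S =>
      ValidW (ltSE n) S (listSE n) (wSE n k)).card : ℤ) =
    valF (R := ℤ) (2*n-1) (fun i => k+i)
      ((List.replicate k 1 ++ List.range' 1 (n-k)).map (fun g => (g, 1))) (WSE n k 0) := by
  rw [count_opL _ _ (listSE_nodup n), listSE, rowsL_eq, opL_rows _ _ (fun y => y), ← gam_list n k h,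
    WSE_zero n k h]
  · apply rows_cmp (fun _ => Low k) _ _ (fun _ => 2*n-1) (gam k) _ n
    · intro y u hu; exact hu
    · intros
      try dsimp only
      omega
    · intros; dsimp only [gam]; split_ifs <;> omega
    · intros
      try dsimp only
      omega
    · intro y hy1 hy2 u hu l hl1 hl2 _
      apply hu.swp
      revert hl1
      dsimp only [gam]; split_ifs <;> omega
    · intro y hy1 hy2 u hu l hl1 hl2
      apply hu.nodesc
      revert hl1 hl2
      dsimp only [gam]; split_ifs <;> omega
    · intros; (try dsimp only at *); omega
    · exact le_rfl
    · omega
    · constructor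
      · intro j hj; unfold wSE; split_ifs; omega
      · intro j hj; unfold wSE; split_ifs <;> omega
  · intro y hy
    rw [List.mem_range'_1] at hy
    rw [opL_row (ltSE n) (cellSE y) (2*n-1)]
    · congr 1; omega
    · omega
    · intro s hs
      simp only [ltSE, cellSE]; omega

lemma countNE (n k : ℕ) (hn : 0 < n) (h : k ≤ n) :
    (((listNE n).toFinset.powerset.filter fun S =>
      ValidW ltNE S (listNE n) (wNE n k)).card : ℤ) =
    valF (R := ℤ) (3*n) (fun i => 2*k+2*i-1)
      ((List.replicate k 1 ++ List.range' 1 (n-k)).map (fun g => (g, 1))) (WNE n k 0) := by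
  rw [count_opL _ _ (listNE_nodup n), listNE, rowsL_eq, opL_rows _ _ (fun y => 2*y-1),
    ← gam_list n k h, WNE_zero n k h]
  · apply rows_cmp (fun y u => Low (2*k) u ∧ ∀ l, 2*n+y-1 ≤ l → ¬ u (l+1) < u l) _ _
      (fun y => 2*n+y-2) (gam k) _ n
    · intro y u hu; exact ⟨hu.1, fun l hl => hu.2 l (by omega)⟩
    · intros
      try dsimp only
      omega
    · intros; dsimp only [gam]; split_ifs <;> omega
    · intros
      try dsimp only
      omega
    · intro y hy1 hy2 u hu l hl1 hl2 _
      try dsimp only at hl2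
      constructor
      · apply hu.1.swp
        revert hl1
        dsimp only [gam]; split_ifs <;> omega
      · intro j hj
        have := hu.2 j hj
        unfold swp
        rw [if_neg (by omega), if_neg (by omega), if_neg (by omega), if_neg (by omega)]
        exact this
    · intro y hy1 hy2 u hu l hl1 hl2
      apply hu.1.nodesc
      revert hl1 hl2
      dsimp only [gam]; split_ifs <;> omega
    · intro y hy1 hy2 u hu l hl1 hl2
      try dsimp only at hl1
      exact hu.2 l (by omega)
    · exact le_rfl
    · omega
    · refine ⟨⟨?_, ?_⟩, ?_⟩
      · intro j hj; unfold wNE; split_ifs; omega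
      · intro j hj; unfold wNE; split_ifs <;> omega
      · intro j hj; unfold wNE; split_ifs <;> omega
  · intro y hy
    rw [List.mem_range'_1] at hy
    rw [opL_row ltNE (cellNE n y) (2*n+y-2)]
    · congr 1; omega
    · omega
    · intro s hs
      simp only [ltNE, cellNE]; omega

theorem hmain (n k : ℕ) (hn : 0 < n) (h : k ≤ n) :
    ((listNE n).toFinset.powerset.filter fun S => ValidW ltNE S (listNE n) (wNE n k)).card =
    ((listSE n).toFinset.powerset.filter fun S => ValidW (ltSE n) S (listSE n) (wSE n k)).card := by
  have h1 := countNE n k hn h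
  have h2 := countSE n k hn h
  have h3 := main_one (setupSE n k hn h) (setupNE n k hn h) k
  rw [← h3, ← h2] at h1
  exact_mod_cast h1

end MaxFill

theorem stmt17 (n k : ℕ) (hn : 0 < n) (hk : 0 < k) :
    ((cellsP n).powerset.filter fun F => neLen F = k ∧
        ∀ c ∈ cellsP n, c ∉ F → neLen F < neLen (insert c F)).card =
    ((cellsP n).powerset.filter fun F => seLen F = k ∧
        ∀ c ∈ cellsP n, c ∉ F → seLen F < seLen (insert c F)).card := by
  exact MaxFill.final n k hn (fun h => MaxFill.hmain n k hn h)
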